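/- arXiv:1302.3773 — 7 statements merged into one kernel-verified Lean document; each statement's English description precedes it below -/
import Mathlib

section
/- Let κ be a nonzero positive Radon measure on ℝ, and let u↑, u↓ be solutions of (1/2)u″ = uκ on ℝ, u↑ positive non-decreasing with right-derivative g↑ and u↓ positive non-increasing with right-derivative g↓, normalized so that u↓(x)·g↑(x) − u↑(x)·g↓(x) = 2 for all x ∈ ℝ; set G(x,y) := u↑(min(x,y))·u↓(max(x,y)). Let f : ℝ → ℝ be a bounded Borel function with compact support, and define F(x) := ∫_ℝ G(x,y) f(y) κ(dy) and ψ(x) := g↓(x)·∫_{(−∞,x]} u↑ f dκ + g↑(x)·∫_{(x,+∞)} u↓ f dκ. Then ∫_ℝ F f dκ = ∫_ℝ F² dκ + (1/2)∫_ℝ ψ(x)² dx. In particular 0 ≤ ∫_ℝ F² dκ ≤ ∫_ℝ F f dκ, so the integral operator with kernel G is positive semi-definite and contracting on L²(κ). -/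
open MeasureTheory Set

/-- `u` is a solution of `(1/2) u'' = u κ` on `ℝ`, where `κ` is a positive Radon
measure, and `g` is the right-continuous right-derivative of `u`. -/
def IsSolKappaR (κ : Measure ℝ) (u g : ℝ → ℝ) : Prop :=
  Continuous u ∧
  (∀ x : ℝ, ContinuousWithinAt g (Ici x) x) ∧
  (∀ x' x : ℝ, u x = u x' + ∫ t in x'..x, g t) ∧
  (∀ x' x : ℝ, x' ≤ x → g x - g x' = 2 * ∫ t in Ioc x' x, u t ∂κ)

/-- Fubini on the two triangles of the plane; the diagonal contributes the common atoms. -/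
theorem integral_mul_setIntegral_Iic_add {μ ν : Measure ℝ} [SFinite μ] [SFinite ν]
    {p q : ℝ → ℝ} (hp : Integrable p μ) (hq : Integrable q ν) :
    Integrable (fun y ↦ p y * ∫ z in Iic y, q z ∂ν) μ ∧
    Integrable (fun z ↦ q z * ∫ y in Iic z, p y ∂μ) ν ∧
    (∫ y, p y * ∫ z in Iic y, q z ∂ν ∂μ) + (∫ z, q z * ∫ y in Iic z, p y ∂μ ∂ν) =
      (∫ y, p y ∂μ) * (∫ z, q z ∂ν) + ∫ y, p y * q y * ν.real {y} ∂μ := by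
  have key : Integrable (fun w : ℝ × ℝ ↦ p w.1 * q w.2) (μ.prod ν) := hp.mul_prod hq
  have h1 : Integrable ({w : ℝ × ℝ | w.2 ≤ w.1}.indicator fun w ↦ p w.1 * q w.2) (μ.prod ν) :=
    key.indicator (measurableSet_le measurable_snd measurable_fst)
  have h2 : Integrable ({w : ℝ × ℝ | w.1 ≤ w.2}.indicator fun w ↦ p w.1 * q w.2) (μ.prod ν) :=
    key.indicator (measurableSet_le measurable_fst measurable_snd)
  have e1 (y : ℝ) : ∫ z, {w : ℝ × ℝ | w.2 ≤ w.1}.indicator (fun w ↦ p w.1 * q w.2) (y, z) ∂ν =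
      p y * ∫ z in Iic y, q z ∂ν := by
    rw [← integral_const_mul, ← integral_indicator measurableSet_Iic]; rfl
  have e2 (y : ℝ) : ∫ z, {w : ℝ × ℝ | w.1 ≤ w.2}.indicator (fun w ↦ p w.1 * q w.2) (y, z) ∂ν =
      p y * ∫ z in Ici y, q z ∂ν := by
    rw [← integral_const_mul, ← integral_indicator measurableSet_Ici]; rfl
  have e3 (z : ℝ) : ∫ y, {w : ℝ × ℝ | w.1 ≤ w.2}.indicator (fun w ↦ p w.1 * q w.2) (y, z) ∂μ =
      q z * ∫ y in Iic z, p y ∂μ := by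
    rw [← integral_const_mul, ← integral_indicator measurableSet_Iic]
    congr 1; ext y; simp only [indicator, mem_ofPred_eq, mem_Iic, mul_comm]
  have i1 := h1.integral_prod_left
  have i2 := h2.integral_prod_left
  have i3 := h2.integral_prod_right
  have sw := (integral_prod _ h2).symm.trans (integral_prod_symm _ h2)
  simp only [e1, e2, e3] at i1 i2 i3 sw
  refine ⟨i1, i3, ?_⟩
  rw [← sw, ← integral_add i1 i2]
  have split (y : ℝ) : p y * (∫ z in Iic y, q z ∂ν) + p y * (∫ z in Ici y, q z ∂ν) =
      p y * (∫ z, q z ∂ν) + p y * q y * ν.real {y} := by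
    have a := setIntegral_union (μ := ν) (f := q) (s := Iio y) (t := {y})
      (by simp) (measurableSet_singleton y) hq.integrableOn hq.integrableOn
    rw [show Iio y ∪ {y} = Iic y by ext; simp [le_iff_lt_or_eq, or_comm], integral_singleton,
      smul_eq_mul] at a
    have b := integral_add_compl (μ := ν) (f := q) (s := Iio y) measurableSet_Iio hq
    rw [compl_Iio] at b
    rw [a, ← b]; ring
  simp only [split]
  have i4 : Integrable (fun y ↦ p y * q y * ν.real {y}) μ := by
    refine ((i1.add i2).sub (hp.mul_const (∫ z, q z ∂ν))).congr (.of_forall fun y ↦ ?_)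
    simp only [Pi.add_apply, Pi.sub_apply, split]; ring
  rw [integral_add (hp.mul_const _) i4, integral_mul_const]

/-- Integration by parts for two functions of bounded variation with densities `p`, `q`. -/
theorem mul_sub_mul_eq_setIntegral_Ioc {μ ν : Measure ℝ} [SFinite μ] [SFinite ν]
    {M N p q : ℝ → ℝ} {a b : ℝ} (hab : a ≤ b)
    (hp : IntegrableOn p (Ioc a b) μ) (hq : IntegrableOn q (Ioc a b) ν)
    (hM : ∀ x, a ≤ x → M x - M a = ∫ t in Ioc a x, p t ∂μ)
    (hN : ∀ x, a ≤ x → N x - N a = ∫ t in Ioc a x, q t ∂ν) :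
    IntegrableOn (fun y ↦ p y * N y) (Ioc a b) μ ∧
    IntegrableOn (fun y ↦ q y * M y) (Ioc a b) ν ∧
    M b * N b - M a * N a = (∫ y in Ioc a b, p y * N y ∂μ) + (∫ y in Ioc a b, q y * M y ∂ν)
      - ∫ y in Ioc a b, p y * q y * ν.real {y} ∂μ := by
  obtain ⟨h1, h2, h3⟩ := integral_mul_setIntegral_Iic_add hp hq
  have res (ρ : Measure ℝ) {y : ℝ} (hy : y ∈ Ioc a b) :
      (ρ.restrict (Ioc a b)).restrict (Iic y) = ρ.restrict (Ioc a y) := by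
    rw [Measure.restrict_restrict measurableSet_Iic]
    congr 1; ext z; simp only [mem_inter_iff, mem_Iic, mem_Ioc] at *; grind
  have c1 : EqOn (fun y ↦ p y * ∫ z in Iic y, q z ∂(ν.restrict (Ioc a b)))
      (fun y ↦ p y * N y - p y * N a) (Ioc a b) := fun y hy ↦ by
    simp only [res ν hy, ← hN y hy.1.le]; ring
  have c2 : EqOn (fun y ↦ q y * ∫ z in Iic y, p z ∂(μ.restrict (Ioc a b)))
      (fun y ↦ q y * M y - q y * M a) (Ioc a b) := fun y hy ↦ by
    simp only [res μ hy, ← hM y hy.1.le]; ring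
  have c3 : EqOn (fun y ↦ p y * q y * (ν.restrict (Ioc a b)).real {y})
      (fun y ↦ p y * q y * ν.real {y}) (Ioc a b) := fun y hy ↦ by
    simp only
    rw [measureReal_restrict_apply (measurableSet_singleton y),
      inter_eq_left.2 (singleton_subset_iff.2 hy)]
  have i1 := IntegrableOn.congr_fun h1 c1 measurableSet_Ioc
  have i2 := IntegrableOn.congr_fun h2 c2 measurableSet_Ioc
  have hpc : IntegrableOn (fun y ↦ p y * N a) (Ioc a b) μ := hp.mul_const _
  have hqc : IntegrableOn (fun y ↦ q y * M a) (Ioc a b) ν := hq.mul_const _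
  have j1 : IntegrableOn (fun y ↦ p y * N y) (Ioc a b) μ :=
    (i1.add hpc).congr (.of_forall fun y ↦ by simp)
  have j2 : IntegrableOn (fun y ↦ q y * M y) (Ioc a b) ν :=
    (i2.add hqc).congr (.of_forall fun y ↦ by simp)
  refine ⟨j1, j2, ?_⟩
  rw [setIntegral_congr_fun measurableSet_Ioc c1, setIntegral_congr_fun measurableSet_Ioc c2,
    setIntegral_congr_fun measurableSet_Ioc c3, integral_sub j1 hpc, integral_sub j2 hqc,
    integral_mul_const, integral_mul_const, ← hM b hab, ← hN b hab] at h3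
  linarith

theorem Continuous.integrable_mul_of_bdd_hasCompactSupport {κ : Measure ℝ}
    [IsLocallyFiniteMeasure κ] {φ f : ℝ → ℝ} (hφ : Continuous φ) (hf : Measurable f) {C : ℝ}
    (hC : ∀ x, |f x| ≤ C) (hs : HasCompactSupport f) : Integrable (fun x ↦ φ x * f x) κ := by
  have h : IntegrableOn (fun x ↦ φ x * f x) (tsupport f) κ :=
    (hφ.continuousOn.integrableOn_compact hs).mul_bdd hf.aestronglyMeasurable
      (.of_forall fun x ↦ hC x)
  refine (integrableOn_iff_integrable_of_support_subset fun x hx ↦ subset_tsupport f ?_).1 h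
  exact fun h0 ↦ hx (by simp [h0])

namespace IsSolKappaR

variable {κ : Measure ℝ} {u g : ℝ → ℝ}

theorem monotone_rightDeriv (h : IsSolKappaR κ u g) (hu : ∀ x, 0 < u x) : Monotone g := by
  intro x y hxy
  have := h.2.2.2 x y hxy
  have : 0 ≤ ∫ t in Ioc x y, u t ∂κ := integral_nonneg fun t ↦ (hu t).le
  linarith

theorem sub_eq_setIntegral (h : IsSolKappaR κ u g) {x' x : ℝ} (hx : x' ≤ x) :
    u x - u x' = ∫ t in Ioc x' x, g t := by
  rw [h.2.2.1 x' x, intervalIntegral.integral_of_le hx]; ring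

theorem mul_sub_le (h : IsSolKappaR κ u g) (hu : ∀ x, 0 < u x) {x' x : ℝ} (hx : x' ≤ x) :
    g x' * (x - x') ≤ u x - u x' := by
  have hg := h.monotone_rightDeriv hu
  have := intervalIntegral.integral_mono_on (μ := volume) hx
    (intervalIntegrable_const (c := g x')) (hg.intervalIntegrable) fun t ht ↦ hg ht.1
  rw [intervalIntegral.integral_const, smul_eq_mul] at this
  linarith [h.2.2.1 x' x]

theorem sub_le_mul (h : IsSolKappaR κ u g) (hu : ∀ x, 0 < u x) {x' x : ℝ} (hx : x' ≤ x) :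
    u x - u x' ≤ g x * (x - x') := by
  have hg := h.monotone_rightDeriv hu
  have := intervalIntegral.integral_mono_on (μ := volume) hx
    (hg.intervalIntegrable) (intervalIntegrable_const (c := g x)) fun t ht ↦ hg ht.2
  rw [intervalIntegral.integral_const, smul_eq_mul] at this
  linarith [h.2.2.1 x' x]

theorem rightDeriv_nonneg (h : IsSolKappaR κ u g) (hu : ∀ x, 0 < u x) (hm : Monotone u) (x : ℝ) :
    0 ≤ g x := by
  have := h.sub_le_mul hu (show x - 1 ≤ x by linarith)
  have := hm (show x - 1 ≤ x by linarith)
  linarith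

theorem rightDeriv_nonpos (h : IsSolKappaR κ u g) (hu : ∀ x, 0 < u x) (hm : Antitone u) (x : ℝ) :
    g x ≤ 0 := by
  have := h.mul_sub_le hu (show x ≤ x + 1 by linarith)
  have := hm (show x ≤ x + 1 by linarith)
  linarith

theorem integrableOn_rightDeriv_sq_Ioi (h : IsSolKappaR κ u g) (hu : ∀ x, 0 < u x)
    (hm : Antitone u) (R : ℝ) : IntegrableOn (fun x ↦ g x ^ 2) (Ioi R) := by
  have hg := h.monotone_rightDeriv hu
  have hg0 := h.rightDeriv_nonpos hu hm
  have i1 : IntegrableOn g (Ioi R) := by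
    refine integrableOn_Ioi_of_intervalIntegral_norm_bounded (l := Filter.atTop)
      (b := fun n : ℕ ↦ (n : ℝ)) (u R) R
      (fun n ↦ hg.intervalIntegrable.1) tendsto_natCast_atTop_atTop ?_
    filter_upwards with n
    simp only [Real.norm_of_nonpos (hg0 _)]
    rw [intervalIntegral.integral_neg]
    linarith [h.2.2.1 R n, hu n]
  have := i1.mul_bdd (c := -g R) hg.measurable.aestronglyMeasurable (g := g)
    ((ae_restrict_iff' measurableSet_Ioi).2 <| .of_forall fun x hx ↦ by
      rw [Real.norm_of_nonpos (hg0 x)]; exact neg_le_neg (hg (le_of_lt hx)))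
  simpa only [sq, IntegrableOn] using this

theorem integrableOn_rightDeriv_sq_Iic (h : IsSolKappaR κ u g) (hu : ∀ x, 0 < u x)
    (hm : Monotone u) (R : ℝ) : IntegrableOn (fun x ↦ g x ^ 2) (Iic R) := by
  have hg := h.monotone_rightDeriv hu
  have hg0 := h.rightDeriv_nonneg hu hm
  have i1 : IntegrableOn g (Iic R) := by
    refine integrableOn_Iic_of_intervalIntegral_norm_bounded (l := Filter.atTop)
      (a := fun n : ℕ ↦ -(n : ℝ)) (u R) R
      (fun n ↦ hg.intervalIntegrable.1)
      (Filter.tendsto_neg_atTop_atBot.comp tendsto_natCast_atTop_atTop) ?_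
    filter_upwards with n
    simp only [Real.norm_of_nonneg (hg0 _)]
    linarith [h.2.2.1 (-n) R, hu (-n)]
  have := i1.mul_bdd (c := g R) hg.measurable.aestronglyMeasurable (g := g)
    ((ae_restrict_iff' measurableSet_Iic).2 <| .of_forall fun x hx ↦ by
      rw [Real.norm_of_nonneg (hg0 x)]; exact hg hx)
  simpa only [sq, IntegrableOn] using this

theorem tendsto_mul_rightDeriv_atTop (h : IsSolKappaR κ u g) (hu : ∀ x, 0 < u x)
    (hm : Antitone u) : Filter.Tendsto (fun x ↦ u x * g x) Filter.atTop (nhds 0) := by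
  refine squeeze_zero_norm' (a := fun x ↦ u 0 ^ 2 / x) ?_
    (tendsto_const_nhds.div_atTop Filter.tendsto_id)
  filter_upwards [Filter.eventually_gt_atTop 0] with x hx
  have hg0 := h.rightDeriv_nonpos hu hm x
  have h1 := h.sub_le_mul hu hx.le
  rw [le_div_iff₀ hx, norm_mul, Real.norm_of_nonneg (hu x).le, Real.norm_of_nonpos hg0]
  have h2 : -g x * x ≤ u 0 := by nlinarith [hu x]
  calc u x * -g x * x = u x * (-g x * x) := by ring
    _ ≤ u 0 * u 0 := mul_le_mul (hm hx.le) h2 (mul_nonneg (by linarith) hx.le) (hu 0).le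
    _ = _ := by ring

theorem tendsto_mul_rightDeriv_atBot (h : IsSolKappaR κ u g) (hu : ∀ x, 0 < u x)
    (hm : Monotone u) : Filter.Tendsto (fun x ↦ u x * g x) Filter.atBot (nhds 0) := by
  refine squeeze_zero_norm' (a := fun x ↦ u 0 ^ 2 / (-x)) ?_
    (tendsto_const_nhds.div_atTop Filter.tendsto_neg_atBot_atTop)
  filter_upwards [Filter.eventually_lt_atBot 0] with x hx
  have hg0 := h.rightDeriv_nonneg hu hm x
  have h1 := h.mul_sub_le hu hx.le
  have hx' : 0 < -x := by linarith
  rw [le_div_iff₀ hx', norm_mul, Real.norm_of_nonneg (hu x).le, Real.norm_of_nonneg hg0]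
  have h2 : g x * -x ≤ u 0 := by nlinarith [hu x]
  calc u x * g x * -x = u x * (g x * -x) := by ring
    _ ≤ u 0 * u 0 := mul_le_mul (hm hx.le) h2 (mul_nonneg hg0 hx'.le) (hu 0).le
    _ = _ := by ring

variable [IsLocallyFiniteMeasure κ]

theorem integrableOn_sq_Ioi (h : IsSolKappaR κ u g) (hu : ∀ x, 0 < u x) (hm : Antitone u) (R : ℝ) :
    IntegrableOn (fun x ↦ u x ^ 2) (Ioi R) κ := by
  have i1 : IntegrableOn u (Ioi R) κ := by
    refine integrableOn_Ioi_of_intervalIntegral_norm_bounded (l := Filter.atTop)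
      (b := fun n : ℕ ↦ (n : ℝ)) (-g R / 2) R
      (fun n ↦ h.1.integrableOn_Ioc) tendsto_natCast_atTop_atTop ?_
    filter_upwards [tendsto_natCast_atTop_atTop.eventually_ge_atTop R] with n hn
    rw [intervalIntegral.integral_of_le hn]
    simp only [Real.norm_of_nonneg (hu _).le]
    linarith [h.2.2.2 R n hn, h.rightDeriv_nonpos hu hm n]
  have := i1.mul_bdd (c := u R) h.1.aestronglyMeasurable (g := u)
    ((ae_restrict_iff' measurableSet_Ioi).2 <| .of_forall fun x hx ↦ by
      rw [Real.norm_of_nonneg (hu x).le]; exact hm (le_of_lt hx))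
  simpa only [sq, IntegrableOn] using this

theorem integrableOn_sq_Iic (h : IsSolKappaR κ u g) (hu : ∀ x, 0 < u x) (hm : Monotone u) (R : ℝ) :
    IntegrableOn (fun x ↦ u x ^ 2) (Iic R) κ := by
  have i1 : IntegrableOn u (Iic R) κ := by
    refine integrableOn_Iic_of_intervalIntegral_norm_bounded (l := Filter.atTop)
      (a := fun n : ℕ ↦ -(n : ℝ)) (g R / 2) R
      (fun n ↦ h.1.integrableOn_Ioc)
      (Filter.tendsto_neg_atTop_atBot.comp tendsto_natCast_atTop_atTop) ?_
    filter_upwards [tendsto_natCast_atTop_atTop.eventually_ge_atTop (-R)] with n hn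
    have hn : -(n : ℝ) ≤ R := by linarith
    rw [intervalIntegral.integral_of_le hn]
    simp only [Real.norm_of_nonneg (hu _).le]
    linarith [h.2.2.2 _ R hn, h.rightDeriv_nonneg hu hm (-n)]
  have := i1.mul_bdd (c := u R) h.1.aestronglyMeasurable (g := u)
    ((ae_restrict_iff' measurableSet_Iic).2 <| .of_forall fun x hx ↦ by
      rw [Real.norm_of_nonneg (hu x).le]; exact hm hx)
  simpa only [sq, IntegrableOn] using this

end IsSolKappaR

/-- energy identity for the Green operator of `(1/2) d²/dx² − κ`:
`∫ F f dκ = ∫ F² dκ + (1/2) ∫ ψ² dx`, so this operator is positive semi-definite and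
contracting on `L²(κ)`. -/
theorem green_operator_energy_identity
    (κ : Measure ℝ) [IsLocallyFiniteMeasure κ] (hκ0 : κ ≠ 0)
    (uup udown gup gdown : ℝ → ℝ)
    (hup : IsSolKappaR κ uup gup) (hdown : IsSolKappaR κ udown gdown)
    (huppos : ∀ x, 0 < uup x) (hupmono : Monotone uup)
    (hdownpos : ∀ x, 0 < udown x) (hdownanti : Antitone udown)
    (hW : ∀ x, udown x * gup x - uup x * gdown x = 2)
    (f : ℝ → ℝ) (hfmeas : Measurable f) (hfbdd : ∃ C : ℝ, ∀ x, |f x| ≤ C)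
    (hfsupp : HasCompactSupport f)
    (F ψ : ℝ → ℝ)
    (hF : ∀ x, F x = ∫ y, (uup (min x y) * udown (max x y)) * f y ∂κ)
    (hψ : ∀ x, ψ x = gdown x * (∫ y in Iic x, uup y * f y ∂κ)
        + gup x * (∫ y in Ioi x, udown y * f y ∂κ)) :
    (∫ x, F x * f x ∂κ)
        = (∫ x, (F x) ^ 2 ∂κ) + 1 / 2 * (∫ x, (ψ x) ^ 2) ∧
      0 ≤ (∫ x, (F x) ^ 2 ∂κ) ∧
      (∫ x, (F x) ^ 2 ∂κ) ≤ (∫ x, F x * f x ∂κ) := by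
  obtain ⟨C, hC⟩ := hfbdd
  obtain ⟨R, hR⟩ : ∃ R : ℝ, ∀ y, R ≤ |y| → f y = 0 := by
    obtain ⟨R, hR⟩ := hfsupp.isCompact.isBounded.subset_closedBall 0
    refine ⟨R + 1, fun y hy ↦ ?_⟩
    by_contra h
    have := hR (subset_tsupport f h)
    rw [mem_closedBall_zero_iff, Real.norm_eq_abs] at this
    linarith
  have hint {φ : ℝ → ℝ} (hφ : Continuous φ) : Integrable (fun x ↦ φ x * f x) κ :=
    hφ.integrable_mul_of_bdd_hasCompactSupport hfmeas hC hfsupp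
  have cup := hup.1
  have cdown := hdown.1
  have iup := hint cup
  have idown := hint cdown
  have mup := hup.monotone_rightDeriv huppos
  have mdown := hdown.monotone_rightDeriv hdownpos
  set A : ℝ → ℝ := fun x ↦ ∫ y in Iic x, uup y * f y ∂κ with hA
  set B : ℝ → ℝ := fun x ↦ ∫ y in Ioi x, udown y * f y ∂κ with hB
  have hFAB (x : ℝ) : F x = udown x * A x + uup x * B x := by
    have hG := hint (φ := fun y ↦ uup (min x y) * udown (max x y)) (by fun_prop)
    rw [hF, ← integral_add_compl measurableSet_Iic hG, compl_Iic, hA, hB,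
      ← integral_const_mul, ← integral_const_mul]
    congr 1
    · refine setIntegral_congr_fun measurableSet_Iic fun y hy ↦ ?_
      simp only [min_eq_right (show y ≤ x from hy), max_eq_left (show y ≤ x from hy)]; ring
    · refine setIntegral_congr_fun measurableSet_Ioi fun y hy ↦ ?_
      simp only [min_eq_left (le_of_lt (show x < y from hy)),
        max_eq_right (le_of_lt (show x < y from hy))]; ring
  have hψAB (x : ℝ) : ψ x = gdown x * A x + gup x * B x := hψ x
  have dA (a x : ℝ) (hax : a ≤ x) : A x - A a = ∫ y in Ioc a x, uup y * f y ∂κ := by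
    rw [hA]
    simp only
    rw [intervalIntegral.integral_Iic_sub_Iic iup.integrableOn iup.integrableOn,
      intervalIntegral.integral_of_le hax]
  have dB (a x : ℝ) (hax : a ≤ x) : B x - B a = ∫ y in Ioc a x, -(udown y * f y) ∂κ := by
    have h := setIntegral_union (μ := κ) (Ioc_disjoint_Ioi le_rfl) measurableSet_Ioi
      (idown.integrableOn (s := Ioc a x)) (idown.integrableOn (s := Ioi x))
    rw [Ioc_union_Ioi_eq_Ioi hax] at h
    rw [integral_neg, hB]
    linarith
  have hjump (q : ℝ → ℝ) (s : Set ℝ) : ∫ y in s, q y * (volume : Measure ℝ).real {y} ∂κ = 0 := by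
    simp [Measure.real]
  have dF (a b : ℝ) (hab : a ≤ b) :
      IntegrableOn ψ (Ioc a b) ∧ F b - F a = ∫ x in Ioc a b, ψ x := by
    obtain ⟨p1, q1, e1⟩ := mul_sub_mul_eq_setIntegral_Ioc (μ := κ) (ν := volume) hab
      iup.integrableOn (mdown.intervalIntegrable (a := a) (b := b)).1 (dA a)
      (fun x hx ↦ hdown.sub_eq_setIntegral hx)
    obtain ⟨p2, q2, e2⟩ := mul_sub_mul_eq_setIntegral_Ioc (μ := κ) (ν := volume)
      (p := fun y ↦ -(udown y * f y)) hab idown.neg.integrableOn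
      (mup.intervalIntegrable (a := a) (b := b)).1 (dB a) (fun x hx ↦ hup.sub_eq_setIntegral hx)
    rw [hjump, sub_zero] at e1 e2
    rw [show ψ = fun x ↦ gdown x * A x + gup x * B x from funext hψAB]
    refine ⟨q1.add q2, ?_⟩
    rw [integral_add q1 q2]
    have e3 : ∫ y in Ioc a b, -(udown y * f y) * uup y ∂κ =
        -∫ y in Ioc a b, uup y * f y * udown y ∂κ := by
      rw [← integral_neg]; congr 1; ext y; ring
    rw [hFAB, hFAB]
    linarith
  have cF : Continuous F := by
    have h : F = fun x ↦ F 0 + ∫ t in (0 : ℝ)..x, ψ t := by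
      ext x
      rcases le_total 0 x with h | h
      · rw [intervalIntegral.integral_of_le h, ← (dF 0 x h).2]; ring
      · rw [intervalIntegral.integral_of_ge h, ← (dF x 0 h).2]; ring
    rw [h]
    refine continuous_const.add (intervalIntegral.continuous_primitive (fun a b ↦ ?_) 0)
    rcases le_total a b with h | h
    · exact (intervalIntegrable_iff_integrableOn_Ioc_of_le h).2 (dF a b h).1
    · exact ((intervalIntegrable_iff_integrableOn_Ioc_of_le h).2 (dF b a h).1).symm
  have dψ (a b : ℝ) (hab : a ≤ b) : ψ b - ψ a = ∫ y in Ioc a b, 2 * (F y - f y) ∂κ := by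
    have dg {u g : ℝ → ℝ} (h : IsSolKappaR κ u g) (x : ℝ) (hx : a ≤ x) :
        g x - g a = ∫ t in Ioc a x, 2 * u t ∂κ := by
      rw [integral_const_mul, h.2.2.2 a x hx]
    obtain ⟨p1, q1, e1⟩ := mul_sub_mul_eq_setIntegral_Ioc (μ := κ) (ν := κ)
      (q := fun y ↦ 2 * udown y) hab iup.integrableOn
      ((continuous_const.mul cdown).integrableOn_Ioc) (dA a) (dg hdown)
    obtain ⟨p2, q2, e2⟩ := mul_sub_mul_eq_setIntegral_Ioc (μ := κ) (ν := κ)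
      (p := fun y ↦ -(udown y * f y))
      (q := fun y ↦ 2 * uup y) hab idown.neg.integrableOn
      ((continuous_const.mul cup).integrableOn_Ioc) (dB a) (dg hup)
    have e3 : ∫ y in Ioc a b, -(udown y * f y) * (2 * uup y) * κ.real {y} ∂κ =
        -∫ y in Ioc a b, uup y * f y * (2 * udown y) * κ.real {y} ∂κ := by
      rw [← integral_neg]; congr 1; ext y; ring
    have e4 : ∫ y in Ioc a b, 2 * (F y - f y) ∂κ =
        ((∫ y in Ioc a b, uup y * f y * gdown y ∂κ) + ∫ y in Ioc a b, 2 * udown y * A y ∂κ) +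
        ((∫ y in Ioc a b, -(udown y * f y) * gup y ∂κ) + ∫ y in Ioc a b, 2 * uup y * B y ∂κ) := by
      rw [← integral_add p1 q1, ← integral_add p2 q2]
      refine Eq.trans ?_ (integral_add (p1.add q1) (p2.add q2))
      congr 1; ext y
      rw [hFAB]
      linear_combination f y * hW y
    rw [e4, hψAB, hψAB]
    linarith
  have hFf := hint cF
  have iFsub {a b : ℝ} : IntegrableOn (fun y ↦ 2 * (F y - f y)) (Ioc a b) κ := by
    have h1 := hint (φ := fun _ ↦ 1) continuous_const
    simp only [one_mul] at h1
    exact (cF.integrableOn_Ioc.sub h1.integrableOn).const_mul 2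
  have energy (a b : ℝ) (hab : a ≤ b) : IntegrableOn (fun x ↦ ψ x ^ 2) (Ioc a b) ∧
      F b * ψ b - F a * ψ a =
        2 * (∫ x in Ioc a b, F x ^ 2 ∂κ) - 2 * (∫ x in Ioc a b, F x * f x ∂κ)
          + ∫ x in Ioc a b, ψ x ^ 2 := by
    obtain ⟨-, q, e⟩ := mul_sub_mul_eq_setIntegral_Ioc (μ := κ) (ν := volume) hab
      iFsub (dF a b hab).1 (dψ a) (fun x hx ↦ (dF a x hx).2)
    rw [hjump, sub_zero] at e
    simp only [sq]
    refine ⟨q, ?_⟩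
    rw [← mul_sub, ← integral_sub (by exact (cF.mul cF).integrableOn_Ioc) hFf.integrableOn,
      ← integral_const_mul]
    convert e using 1
    · ring
    · congr 2; ext y; ring
  have right {x : ℝ} (hx : R ≤ x) :
      F x = (∫ y, uup y * f y ∂κ) * udown x ∧ ψ x = (∫ y, uup y * f y ∂κ) * gdown x := by
    have h0 {y : ℝ} (hy : x < y) : f y = 0 := hR y (by linarith [le_abs_self y])
    have hAx : ∫ y in Iic x, uup y * f y ∂κ = ∫ y, uup y * f y ∂κ :=
      setIntegral_eq_integral_of_forall_compl_eq_zero fun y hy ↦ by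
        rw [h0 (not_le.1 hy), mul_zero]
    have hBx : ∫ y in Ioi x, udown y * f y ∂κ = 0 :=
      setIntegral_eq_zero_of_forall_eq_zero fun y hy ↦ by rw [h0 hy, mul_zero]
    rw [hFAB, hψ, hA, hB]
    simp only [hAx, hBx]
    constructor <;> ring
  have left {x : ℝ} (hx : x ≤ -R) :
      F x = (∫ y, udown y * f y ∂κ) * uup x ∧ ψ x = (∫ y, udown y * f y ∂κ) * gup x := by
    have h0 {y : ℝ} (hy : y ≤ x) : f y = 0 := hR y (by linarith [neg_le_abs y])
    have hBx : ∫ y in Ioi x, udown y * f y ∂κ = ∫ y, udown y * f y ∂κ :=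
      setIntegral_eq_integral_of_forall_compl_eq_zero fun y hy ↦ by
        rw [h0 (not_lt.1 hy), mul_zero]
    have hAx : ∫ y in Iic x, uup y * f y ∂κ = 0 :=
      setIntegral_eq_zero_of_forall_eq_zero fun y hy ↦ by rw [h0 hy, mul_zero]
    rw [hFAB, hψ, hA, hB]
    simp only [hAx, hBx]
    constructor <;> ring
  have glue {μ : Measure ℝ} {h : ℝ → ℝ} (h1 : IntegrableOn h (Iic (-R)) μ)
      (h2 : IntegrableOn h (Ioc (-R) R) μ) (h3 : IntegrableOn h (Ioi R) μ) : Integrable h μ := by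
    rw [← integrableOn_univ]
    refine ((h1.union h2).union h3).mono_set fun x _ ↦ ?_
    simp only [mem_union, mem_Iic, mem_Ioc, mem_Ioi]
    grind
  have iF2 : Integrable (fun x ↦ F x ^ 2) κ := by
    refine glue ?_ (cF.pow 2).integrableOn_Ioc ?_
    · exact IntegrableOn.congr_fun ((hup.integrableOn_sq_Iic huppos hupmono (-R)).const_mul
        ((∫ y, udown y * f y ∂κ) ^ 2)) (fun x hx ↦ by simp only [(left hx).1, mul_pow])
        measurableSet_Iic
    · exact IntegrableOn.congr_fun ((hdown.integrableOn_sq_Ioi hdownpos hdownanti R).const_mul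
        ((∫ y, uup y * f y ∂κ) ^ 2)) (fun x hx ↦ by simp only [(right (le_of_lt hx)).1, mul_pow])
        measurableSet_Ioi
  have iψ2 : Integrable (fun x ↦ ψ x ^ 2) := by
    refine glue ?_ ?_ ?_
    · exact IntegrableOn.congr_fun ((hup.integrableOn_rightDeriv_sq_Iic huppos hupmono
        (-R)).const_mul ((∫ y, udown y * f y ∂κ) ^ 2))
        (fun x hx ↦ by simp only [(left hx).2, mul_pow]) measurableSet_Iic
    · rcases le_total (-R) R with h | h
      · exact (energy _ _ h).1
      · simp [Ioc_eq_empty_of_le h]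
    · exact IntegrableOn.congr_fun ((hdown.integrableOn_rightDeriv_sq_Ioi hdownpos hdownanti
        R).const_mul ((∫ y, uup y * f y ∂κ) ^ 2))
        (fun x hx ↦ by simp only [(right (le_of_lt hx)).2, mul_pow]) measurableSet_Ioi
  have ltop : Filter.Tendsto (fun x ↦ F x * ψ x) Filter.atTop (nhds 0) := by
    have h := (hdown.tendsto_mul_rightDeriv_atTop hdownpos hdownanti).const_mul
      ((∫ y, uup y * f y ∂κ) ^ 2)
    rw [mul_zero] at h
    refine h.congr' ?_
    filter_upwards [Filter.eventually_ge_atTop R] with x hx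
    rw [(right hx).1, (right hx).2]; ring
  have lbot : Filter.Tendsto (fun x ↦ F x * ψ x) Filter.atBot (nhds 0) := by
    have h := (hup.tendsto_mul_rightDeriv_atBot huppos hupmono).const_mul
      ((∫ y, udown y * f y ∂κ) ^ 2)
    rw [mul_zero] at h
    refine h.congr' ?_
    filter_upwards [Filter.eventually_le_atBot (-R)] with x hx
    rw [(left hx).1, (left hx).2]; ring
  have lim {μ : Measure ℝ} {h : ℝ → ℝ} (hh : Integrable h μ) :
      Filter.Tendsto (fun x : ℝ ↦ ∫ t in Ioc (-x) x, h t ∂μ) Filter.atTop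
        (nhds (∫ t, h t ∂μ)) :=
    AECover.integral_tendsto_of_countably_generated
      (aecover_Ioc Filter.tendsto_neg_atTop_atBot Filter.tendsto_id) hh
  have limit := (((lim iF2).const_mul 2).sub ((lim hFf).const_mul 2)).add (lim iψ2)
  have zero := ltop.sub (lbot.comp Filter.tendsto_neg_atTop_atBot)
  have main := tendsto_nhds_unique (limit.congr' (f₂ := fun x ↦ F x * ψ x - F (-x) * ψ (-x)) (by
    filter_upwards [Filter.eventually_ge_atTop 0] with x hx
    exact ((energy (-x) x (by linarith)).2).symm)) zero
  have pos : 0 ≤ ∫ x, ψ x ^ 2 := integral_nonneg fun x ↦ sq_nonneg _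
  refine ⟨by linarith, integral_nonneg fun x ↦ sq_nonneg _, by linarith⟩
end

section
/- Let I be an open interval of ℝ, let m, w : I → ℝ be continuous and positive, and let κ be a positive Radon measure on I. For x ∈ I, let u^{+,x} denote the solution of Lu = 0, with L = (1/m) d/dx ((1/w) d/dx) − κ, satisfying u^{+,x}(x) = 0 and h(x) = 1/w(x) (i.e. right-derivative 1 at x); for y ∈ I, let u^{−,y} denote the solution satisfying u^{−,y}(y) = 0 and h(y) = −1/w(y) (i.e. left-derivative −1 at y). Then for all x ≤ y in I: w(y)·u^{−,y}(x) = w(x)·u^{+,x}(y). -/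
open MeasureTheory Set

/-- `u` is a solution of `L u = 0` on `I`, where
`L = (1/m) d/dx ((1/w) d/dx) − κ` with `κ` a positive Radon measure;
`h = (1/w) u'` is right-continuous. -/
def IsLHarmonicK (I : Set ℝ) (m w : ℝ → ℝ) (κ : Measure ℝ) (u h : ℝ → ℝ) : Prop :=
  ContinuousOn u I ∧
  (∀ x ∈ I, ContinuousWithinAt h (Ici x) x) ∧
  (∀ x' ∈ I, ∀ x ∈ I, u x = u x' + ∫ t in x'..x, w t * h t) ∧
  (∀ x' ∈ I, ∀ x ∈ I, x' ≤ x → h x - h x' = ∫ t in Ioc x' x, u t * m t ∂κ)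

/-- A function whose increments are bounded by `C (b - a) (g b - g a)` has equal endpoint values. -/
lemma eq_endpoints_of_abs_sub_le_mul_mul {F g : ℝ → ℝ} {C x y : ℝ} (hxy : x ≤ y)
    (H : ∀ a b, x ≤ a → a ≤ b → b ≤ y → |F b - F a| ≤ C * (b - a) * (g b - g a)) :
    F y = F x := by
  have key : ∀ n : ℕ, |F y - F x| ≤ C * (y - x) * (g y - g x) / ((n : ℝ) + 1) := by
    intro n
    have hn : (0 : ℝ) < (n : ℝ) + 1 := by positivity
    set d := (y - x) / ((n : ℝ) + 1) with hd
    have hd0 : 0 ≤ d := div_nonneg (sub_nonneg.2 hxy) hn.le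
    have hdn : ((n : ℝ) + 1) * d = y - x := by rw [hd]; field_simp
    have step : ∀ i : ℕ, i ≤ n + 1 →
        |F (x + i * d) - F x| ≤ C * d * (g (x + i * d) - g x) := by
      intro i
      induction i with
      | zero => intro _; simp
      | succ i ih =>
        intro hi
        have h1 := ih (by omega)
        have hi' : ((i : ℝ) + 1) ≤ (n : ℝ) + 1 := by exact_mod_cast hi
        have hle : ((i : ℝ) + 1) * d ≤ ((n : ℝ) + 1) * d := by gcongr
        have hid : 0 ≤ (i : ℝ) * d := by positivity
        have h2 := H (x + i * d) (x + (i + 1) * d) (by linarith) (by linarith) (by linarith)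
        have h3 : x + ((i : ℝ) + 1) * d - (x + i * d) = d := by ring
        rw [h3] at h2
        push_cast
        have h4 := abs_sub_le (F (x + ((i : ℝ) + 1) * d)) (F (x + i * d)) (F x)
        linarith
    have h := step (n + 1) le_rfl
    push_cast at h
    rw [hdn, add_sub_cancel] at h
    calc _ ≤ _ := h
      _ = _ := by rw [hd]; ring
  have hlim : Filter.Tendsto (fun n : ℕ => C * (y - x) * (g y - g x) / ((n : ℝ) + 1))
      Filter.atTop (nhds 0) := by
    simpa [div_eq_mul_inv] using
      (tendsto_one_div_add_atTop_nhds_zero_nat (𝕜 := ℝ)).const_mul (C * (y - x) * (g y - g x))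
  have h0 : |F y - F x| ≤ 0 := ge_of_tendsto' hlim key
  exact sub_eq_zero.1 (abs_nonpos_iff.1 h0)

/-- Quantitative regularity of a solution on a compact interval. -/
lemma IsLHarmonicK.exists_bound {I : Set ℝ} (hIconn : I.OrdConnected) {m w : ℝ → ℝ}
    (hm : ContinuousOn m I) (hw : ContinuousOn w I) {κ : Measure ℝ} {x y : ℝ}
    (hκ : κ (Icc x y) < ⊤) (hx : x ∈ I) (hy : y ∈ I) (hxy : x ≤ y)
    {u h : ℝ → ℝ} (hu : IsLHarmonicK I m w κ u h) :
    (∃ C, 0 ≤ C ∧ (∀ t ∈ Icc x y, |u t| ≤ C) ∧ (∀ t ∈ Icc x y, |h t| ≤ C) ∧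
      (∀ a b, x ≤ a → a ≤ b → b ≤ y → |u b - u a| ≤ C * (b - a)) ∧
      (∀ a b, x ≤ a → a ≤ b → b ≤ y → |h b - h a| ≤ C * κ.real (Ioc a b))) ∧
    (∀ a b, x ≤ a → a ≤ b → b ≤ y → IntervalIntegrable (fun t => w t * h t) volume a b) := by
  obtain ⟨hc, -, hui, hhi⟩ := hu
  have hsub : Icc x y ⊆ I := hIconn.out hx hy
  have hfin : ∀ a b, x ≤ a → b ≤ y → κ (Ioc a b) < ⊤ := fun a b ha hb =>
    (measure_mono (Ioc_subset_Icc_self.trans (Icc_subset_Icc ha hb))).trans_lt hκ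
  obtain ⟨A, hA⟩ := isCompact_Icc.exists_bound_of_continuousOn (hc.mono hsub)
  obtain ⟨B, hB⟩ := isCompact_Icc.exists_bound_of_continuousOn ((hc.mul hm).mono hsub)
  obtain ⟨D, hD⟩ := isCompact_Icc.exists_bound_of_continuousOn (hw.mono hsub)
  have hxm : x ∈ Icc x y := left_mem_Icc.2 hxy
  have hA0 : 0 ≤ A := (norm_nonneg _).trans (hA x hxm)
  have hB0 : 0 ≤ B := (norm_nonneg _).trans (hB x hxm)
  have hD0 : 0 ≤ D := (norm_nonneg _).trans (hD x hxm)
  have hh : ∀ a b, x ≤ a → a ≤ b → b ≤ y → |h b - h a| ≤ B * κ.real (Ioc a b) := by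
    intro a b ha hab hb
    rw [hhi a (hsub ⟨ha, hab.trans hb⟩) b (hsub ⟨ha.trans hab, hb⟩) hab]
    exact norm_setIntegral_le_of_norm_le_const (hfin a b ha hb)
      fun t ht => hB t ⟨ha.trans ht.1.le, ht.2.trans hb⟩
  set E := |h x| + B * κ.real (Ioc x y) with hE
  have hE0 : 0 ≤ E := by positivity
  have hhb : ∀ t ∈ Icc x y, |h t| ≤ E := by
    intro t ht
    have h1 := hh x t le_rfl ht.1 ht.2
    have h2 : B * κ.real (Ioc x t) ≤ B * κ.real (Ioc x y) :=
      mul_le_mul_of_nonneg_left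
        (measureReal_mono (Ioc_subset_Ioc_right ht.2) (hfin x y le_rfl le_rfl).ne) hB0
    have h3 := abs_sub_abs_le_abs_sub (h t) (h x)
    linarith
  have hul : ∀ a b, x ≤ a → a ≤ b → b ≤ y → |u b - u a| ≤ D * E * (b - a) := by
    intro a b ha hab hb
    rw [hui a (hsub ⟨ha, hab.trans hb⟩) b (hsub ⟨ha.trans hab, hb⟩), add_sub_cancel_left]
    have := intervalIntegral.norm_integral_le_of_norm_le_const (a := a) (b := b)
      (f := fun t => w t * h t) (C := D * E) (fun t ht => by
        rw [uIoc_of_le hab] at ht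
        have ht' : t ∈ Icc x y := ⟨ha.trans ht.1.le, ht.2.trans hb⟩
        rw [norm_mul]
        exact mul_le_mul (hD t ht') (hhb t ht') (norm_nonneg _) hD0)
    rwa [abs_of_nonneg (sub_nonneg.2 hab)] at this
  refine ⟨⟨A + B + E + D * E, by positivity, fun t ht => ?_, fun t ht => ?_, ?_, ?_⟩, ?_⟩
  · have := hA t ht
    rw [Real.norm_eq_abs] at this
    have : 0 ≤ D * E := by positivity
    linarith
  · have := hhb t ht
    have : 0 ≤ D * E := by positivity
    linarith
  · intro a b ha hab hb
    refine (hul a b ha hab hb).trans (mul_le_mul_of_nonneg_right ?_ (sub_nonneg.2 hab))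
    linarith
  · intro a b ha hab hb
    refine (hh a b ha hab hb).trans (mul_le_mul_of_nonneg_right ?_ measureReal_nonneg)
    have : 0 ≤ D * E := by positivity
    linarith
  · intro a b ha hab hb
    have hs : uIcc a b ⊆ Icc x y := by rw [uIcc_of_le hab]; exact Icc_subset_Icc ha hb
    have hadd : ∀ s t, a ≤ s → s ≤ t → t ≤ b →
        κ.real (Ioc a t) = κ.real (Ioc a s) + κ.real (Ioc s t) := by
      intro s t hs hst ht
      rw [← Ioc_union_Ioc_eq_Ioc hs hst]
      exact measureReal_union (Ioc_disjoint_Ioc_of_le le_rfl) measurableSet_Ioc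
        (hfin a s ha (hst.trans (ht.trans hb))).ne (hfin s t (ha.trans hs) (ht.trans hb)).ne
    have hk : MonotoneOn (fun t => B * κ.real (Ioc a t)) (uIcc a b) := by
      rw [uIcc_of_le hab]
      intro s hs t ht hst
      have := hadd s t hs.1 hst ht.2
      have : 0 ≤ κ.real (Ioc s t) := measureReal_nonneg
      exact mul_le_mul_of_nonneg_left (by linarith) hB0
    have hhk : MonotoneOn (fun t => h t + B * κ.real (Ioc a t)) (uIcc a b) := by
      rw [uIcc_of_le hab]
      intro s hs t ht hst
      have h1 := (abs_le.1 (hh s t (ha.trans hs.1) hst (ht.2.trans hb))).1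
      have h2 := hadd s t hs.1 hst ht.2
      simp only [h2, mul_add]
      linarith
    have hint : IntervalIntegrable h volume a b := by
      simpa using hhk.intervalIntegrable.sub hk.intervalIntegrable
    exact hint.continuousOn_mul (hw.mono (hs.trans hsub))

/-- The Wronskian of two solutions takes the same value at any two points. -/
lemma IsLHarmonicK.wronskian_eq {I : Set ℝ} (hIconn : I.OrdConnected) {m w : ℝ → ℝ}
    (hm : ContinuousOn m I) (hw : ContinuousOn w I) {κ : Measure ℝ} {x y : ℝ}
    (hκ : κ (Icc x y) < ⊤) (hx : x ∈ I) (hy : y ∈ I) (hxy : x ≤ y)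
    {p p' q q' : ℝ → ℝ} (hp : IsLHarmonicK I m w κ p p') (hq : IsLHarmonicK I m w κ q q') :
    p' y * q y - q' y * p y = p' x * q x - q' x * p x := by
  obtain ⟨⟨P, hP0, hP, hP', hPl, hPk⟩, hPi⟩ := hp.exists_bound hIconn hm hw hκ hx hy hxy
  obtain ⟨⟨Q, hQ0, hQ, hQ', hQl, hQk⟩, hQi⟩ := hq.exists_bound hIconn hm hw hκ hx hy hxy
  obtain ⟨hpc, -, hpu, hph⟩ := hp
  obtain ⟨hqc, -, hqu, hqh⟩ := hq
  have hsub : Icc x y ⊆ I := hIconn.out hx hy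
  have hfin : ∀ a b, x ≤ a → b ≤ y → κ (Ioc a b) < ⊤ := fun a b ha hb =>
    (measure_mono (Ioc_subset_Icc_self.trans (Icc_subset_Icc ha hb))).trans_lt hκ
  obtain ⟨M, hM⟩ := isCompact_Icc.exists_bound_of_continuousOn (hm.mono hsub)
  obtain ⟨D, hD⟩ := isCompact_Icc.exists_bound_of_continuousOn (hw.mono hsub)
  have hxm : x ∈ Icc x y := left_mem_Icc.2 hxy
  have hM0 : 0 ≤ M := (norm_nonneg _).trans (hM x hxm)
  have hD0 : 0 ≤ D := (norm_nonneg _).trans (hD x hxm)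
  have cross : ∀ {r s r₀ s₀ R : ℝ}, |r₀| ≤ P → |s₀| ≤ Q → |r - r₀| ≤ P * R → |s - s₀| ≤ Q * R →
      |s₀ * r - r₀ * s| ≤ 2 * P * Q * R := by
    intro r s r₀ s₀ R h1 h2 h3 h4
    have e : s₀ * r - r₀ * s = s₀ * (r - r₀) - r₀ * (s - s₀) := by ring
    rw [e]
    refine (abs_sub _ _).trans ?_
    rw [abs_mul, abs_mul]
    have := mul_le_mul h2 h3 (abs_nonneg _) hQ0
    have := mul_le_mul h1 h4 (abs_nonneg _) hP0
    linarith
  refine eq_endpoints_of_abs_sub_le_mul_mul (F := fun t => p' t * q t - q' t * p t)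
    (g := fun t => κ.real (Ioc x t)) (C := 2 * P * Q * M + 2 * P * Q * D) hxy ?_
  intro a b ha hab hb
  have haI : a ∈ Icc x y := ⟨ha, hab.trans hb⟩
  have hbI : b ∈ Icc x y := ⟨ha.trans hab, hb⟩
  have hg : κ.real (Ioc x b) - κ.real (Ioc x a) = κ.real (Ioc a b) := by
    rw [← Ioc_union_Ioc_eq_Ioc ha hab,
      measureReal_union (Ioc_disjoint_Ioc_of_le le_rfl) measurableSet_Ioc
        (hfin x a le_rfl (hab.trans hb)).ne (hfin a b ha hb).ne]
    ring
  have hint : ∀ u : ℝ → ℝ, ContinuousOn u I → IntegrableOn (fun t => u t * m t) (Ioc a b) κ := by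
    intro u hu
    obtain ⟨B, hB⟩ := isCompact_Icc.exists_bound_of_continuousOn ((hu.mul hm).mono hsub)
    have hss : Ioc a b ⊆ Icc x y := Ioc_subset_Icc_self.trans (Icc_subset_Icc ha hb)
    exact IntegrableOn.of_bound (hfin a b ha hb)
      (((hu.mul hm).mono (hss.trans hsub)).aestronglyMeasurable measurableSet_Ioc) B
      (ae_restrict_of_forall_mem measurableSet_Ioc fun t ht => hB t (hss ht))
  have e1 : q b * (p' b - p' a) - p b * (q' b - q' a)
      = ∫ t in Ioc a b, (q b * p t - p b * q t) * m t ∂κ := by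
    rw [hph a (hsub haI) b (hsub hbI) hab, hqh a (hsub haI) b (hsub hbI) hab,
      ← integral_const_mul, ← integral_const_mul,
      ← integral_sub ((hint p hpc).const_mul _) ((hint q hqc).const_mul _)]
    congr 1 with t
    ring
  have e2 : q' a * (p b - p a) - p' a * (q b - q a)
      = ∫ t in a..b, w t * (q' a * p' t - p' a * q' t) := by
    rw [hpu a (hsub haI) b (hsub hbI), hqu a (hsub haI) b (hsub hbI), add_sub_cancel_left,
      add_sub_cancel_left, ← intervalIntegral.integral_const_mul,
      ← intervalIntegral.integral_const_mul,
      ← intervalIntegral.integral_sub ((hPi a b ha hab hb).const_mul _)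
        ((hQi a b ha hab hb).const_mul _)]
    congr 1 with t
    ring
  have b1 : |q b * (p' b - p' a) - p b * (q' b - q' a)|
      ≤ 2 * P * Q * (b - a) * M * κ.real (Ioc a b) := by
    rw [e1]
    refine norm_setIntegral_le_of_norm_le_const (f := fun t => (q b * p t - p b * q t) * m t)
      (hfin a b ha hb) fun t ht => ?_
    have htI : t ∈ Icc x y := ⟨ha.trans ht.1.le, ht.2.trans hb⟩
    have hta : b - t ≤ b - a := by linarith [ht.1]
    rw [norm_mul]
    refine mul_le_mul (cross (hP b hbI) (hQ b hbI) ?_ ?_) (hM t htI) (norm_nonneg _) ?_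
    · rw [abs_sub_comm]
      exact (hPl t b htI.1 ht.2 hb).trans (mul_le_mul_of_nonneg_left hta hP0)
    · rw [abs_sub_comm]
      exact (hQl t b htI.1 ht.2 hb).trans (mul_le_mul_of_nonneg_left hta hQ0)
    · have := sub_nonneg.2 hab
      positivity
  have b2 : |q' a * (p b - p a) - p' a * (q b - q a)|
      ≤ D * (2 * P * Q * κ.real (Ioc a b)) * (b - a) := by
    rw [e2]
    have := intervalIntegral.norm_integral_le_of_norm_le_const (a := a) (b := b)
      (f := fun t => w t * (q' a * p' t - p' a * q' t))
      (C := D * (2 * P * Q * κ.real (Ioc a b))) (fun t ht => by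
        rw [uIoc_of_le hab] at ht
        have htI : t ∈ Icc x y := ⟨ha.trans ht.1.le, ht.2.trans hb⟩
        have hk : κ.real (Ioc a t) ≤ κ.real (Ioc a b) :=
          measureReal_mono (Ioc_subset_Ioc_right ht.2) (hfin a b ha hb).ne
        rw [norm_mul]
        exact mul_le_mul (hD t htI) (cross (hP' a haI) (hQ' a haI)
          ((hPk a t ha ht.1.le htI.2).trans (mul_le_mul_of_nonneg_left hk hP0))
          ((hQk a t ha ht.1.le htI.2).trans (mul_le_mul_of_nonneg_left hk hQ0)))
          (norm_nonneg _) hD0)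
    rwa [abs_of_nonneg (sub_nonneg.2 hab)] at this
  have e : p' b * q b - q' b * p b - (p' a * q a - q' a * p a)
      = (q b * (p' b - p' a) - p b * (q' b - q' a))
        - (q' a * (p b - p a) - p' a * (q b - q a)) := by ring
  simp only [hg, e]
  refine (abs_sub _ _).trans ((add_le_add b1 b2).trans (le_of_eq ?_))
  ring

/-- `w(y) · u^{−,y}(x) = w(x) · u^{+,x}(y)` for `x ≤ y` in `I`. -/
theorem wronskian_symmetry_uplus_uminus
    (I : Set ℝ) (hIopen : IsOpen I) (hIconn : I.OrdConnected)
    (m w : ℝ → ℝ)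
    (hm : ContinuousOn m I) (hw : ContinuousOn w I)
    (hmpos : ∀ x ∈ I, 0 < m x) (hwpos : ∀ x ∈ I, 0 < w x)
    (κ : Measure ℝ)
    (hκfin : ∀ x ∈ I, ∀ y ∈ I, κ (Icc x y) < ⊤)
    (x y : ℝ) (hx : x ∈ I) (hy : y ∈ I) (hxy : x ≤ y)
    (p hp : ℝ → ℝ) (hpsol : IsLHarmonicK I m w κ p hp)
    (hp0 : p x = 0) (hp1 : hp x = 1 / w x)
    (q hq : ℝ → ℝ) (hqsol : IsLHarmonicK I m w κ q hq)
    (hq0 : q y = 0) (hq1 : hq y = -(1 / w y)) :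
    w y * q x = w x * p y := by
  have hW := hpsol.wronskian_eq hIconn hm hw (hκfin x hx y hy) hx hy hxy hqsol
  have hwx := (hwpos x hx).ne'
  have hwy := (hwpos y hy).ne'
  rw [hp0, hq0, hp1, hq1] at hW
  field_simp at hW
  linarith
end

section
/- With the glueing construction below, the function ξ : [0, T_max) → ℝ is continuous, and for every t ∈ [0, T_max), θ(t) = inf_{s ∈ [0,t]} ξ(s). -/
open Set

section TruncatedSum

open Filter Topology

variable {x₀ : ℝ} {Q : Set ℝ} {T : ℝ → ℝ}

/-- The total weight of the points of `Q` in `(x₀ - y, x₀)`. -/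
noncomputable def truncatedSum (x₀ : ℝ) (Q : Set ℝ) (T : ℝ → ℝ) (y : ℝ) : ℝ :=
  ∑' q : ↥(Q ∩ Ioo (x₀ - y) x₀), T q.1

theorem truncatedSum_eq_tsum_indicator (y : ℝ) :
    truncatedSum x₀ Q T y = ∑' q, (Q ∩ Ioo (x₀ - y) x₀).indicator T q :=
  tsum_subtype _ _

theorem indicator_le_indicator_apply_of_nonneg {s t : Set ℝ} (hst : s ⊆ t)
    (hT : ∀ q ∈ t, 0 ≤ T q) (q : ℝ) : s.indicator T q ≤ t.indicator T q := by
  by_cases hq : q ∈ s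
  · rw [indicator_of_mem hq, indicator_of_mem (hst hq)]
  · rw [indicator_of_notMem hq]
    exact indicator_nonneg hT q

theorem summable_indicator_Ioo
    (hsum : ∀ a < x₀, Summable fun q : ↥(Q ∩ Ioo a x₀) => T q.1) (y : ℝ) :
    Summable ((Q ∩ Ioo (x₀ - y) x₀).indicator T) := by
  rcases le_or_gt y 0 with hy | hy
  · rw [Ioo_eq_empty (by linarith), inter_empty, indicator_empty]
    exact summable_zero
  · exact summable_subtype_iff_indicator.1 (hsum _ (by linarith))

theorem truncatedSum_nonneg (hT : ∀ q ∈ Q, 0 < T q) (y : ℝ) : 0 ≤ truncatedSum x₀ Q T y :=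
  tsum_nonneg fun q => (hT _ q.2.1).le

theorem truncatedSum_mono (hT : ∀ q ∈ Q, 0 < T q)
    (hsum : ∀ a < x₀, Summable fun q : ↥(Q ∩ Ioo a x₀) => T q.1) :
    Monotone (truncatedSum x₀ Q T) := by
  intro y z hyz
  simp only [truncatedSum_eq_tsum_indicator]
  refine (summable_indicator_Ioo hsum y).tsum_le_tsum (fun q => ?_) (summable_indicator_Ioo hsum z)
  refine indicator_le_indicator_apply_of_nonneg ?_ (fun q hq => ?_) q
  · exact inter_subset_inter_right _ (Ioo_subset_Ioo_left (by linarith))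
  · exact (hT q hq.1).le

theorem indicator_insert_eq_add {q : ℝ} {s : Set ℝ} (hq : q ∉ s) :
    (insert q s).indicator T = fun p => ({q} : Set ℝ).indicator T p + s.indicator T p := by
  rw [insert_eq, indicator_union_of_disjoint (disjoint_singleton_left.2 hq)]

theorem hasSum_indicator_insert
    (hsum : ∀ a < x₀, Summable fun q : ↥(Q ∩ Ioo a x₀) => T q.1) (q : ℝ) :
    HasSum ((insert q (Q ∩ Ioo q x₀)).indicator T) (T q + truncatedSum x₀ Q T (x₀ - q)) := by
  rw [indicator_insert_eq_add (by simp)]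
  refine HasSum.add ?_ ?_
  · simpa using hasSum_single (f := ({q} : Set ℝ).indicator T) q (by simp +contextual)
  · have := (summable_indicator_Ioo hsum (x₀ - q)).hasSum
    rwa [← truncatedSum_eq_tsum_indicator, sub_sub_cancel] at this

theorem truncatedSum_add_le (hQ : Q ⊆ Iio x₀) (hT : ∀ q ∈ Q, 0 < T q)
    (hsum : ∀ a < x₀, Summable fun q : ↥(Q ∩ Ioo a x₀) => T q.1)
    {q z : ℝ} (hq : q ∈ Q) (hz : x₀ - q < z) :
    truncatedSum x₀ Q T (x₀ - q) + T q ≤ truncatedSum x₀ Q T z := by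
  rw [add_comm, ← (hasSum_indicator_insert hsum q).tsum_eq, truncatedSum_eq_tsum_indicator]
  refine (hasSum_indicator_insert hsum q).summable.tsum_le_tsum (fun p => ?_)
    (summable_indicator_Ioo hsum z)
  refine indicator_le_indicator_apply_of_nonneg ?_ (fun p hp => ?_) p
  · rintro p (rfl | hp)
    · exact ⟨hq, by linarith, hQ hq⟩
    · exact ⟨hp.1, by linarith [hp.2.1], hp.2.2⟩
  · exact (hT p hp.1).le

theorem truncatedSum_strictMonoOn (hQ : Q ⊆ Iio x₀) (hQdense : Iio x₀ ⊆ closure Q)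
    (hT : ∀ q ∈ Q, 0 < T q)
    (hsum : ∀ a < x₀, Summable fun q : ↥(Q ∩ Ioo a x₀) => T q.1) :
    StrictMonoOn (truncatedSum x₀ Q T) (Ici 0) := by
  intro y hy z hz hyz
  have hy : 0 ≤ y := hy
  obtain ⟨q, hq, hqQ⟩ := mem_closure_iff.1
    (hQdense (show x₀ - (y + z) / 2 ∈ Iio x₀ by simp only [mem_Iio]; linarith))
    (Ioo (x₀ - z) (x₀ - y)) isOpen_Ioo ⟨by linarith, by linarith⟩
  have h₁ := truncatedSum_mono hT hsum (show y ≤ x₀ - q by linarith [hq.2])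
  have h₂ := truncatedSum_add_le hQ hT hsum hqQ (show x₀ - q < z by linarith [hq.1])
  linarith [hT q hqQ]

theorem tendsto_truncatedSum_of_eventually_mem_iff (hT : ∀ q ∈ Q, 0 < T q)
    (hsum : ∀ a < x₀, Summable fun q : ↥(Q ∩ Ioo a x₀) => T q.1)
    {l : Filter ℝ} {c : ℝ} {s : Set ℝ} (hc : ∀ᶠ z in l, z ≤ c)
    (hs : ∀ q, ∀ᶠ z in l, q ∈ Q ∩ Ioo (x₀ - z) x₀ ↔ q ∈ s) :
    Tendsto (truncatedSum x₀ Q T) l (𝓝 (∑' q, s.indicator T q)) := by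
  have h : truncatedSum x₀ Q T = fun z => ∑' q, (Q ∩ Ioo (x₀ - z) x₀).indicator T q :=
    funext truncatedSum_eq_tsum_indicator
  rw [h]
  refine tendsto_tsum_of_dominated_convergence (summable_indicator_Ioo hsum c) (fun q => ?_) ?_
  · refine tendsto_const_nhds.congr' ?_
    filter_upwards [hs q] with z hz
    by_cases hq : q ∈ s
    · rw [indicator_of_mem hq, indicator_of_mem (hz.2 hq)]
    · rw [indicator_of_notMem hq, indicator_of_notMem (mt hz.1 hq)]
  · filter_upwards [hc] with z hz q
    have hnn : 0 ≤ (Q ∩ Ioo (x₀ - z) x₀).indicator T q :=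
      indicator_nonneg (fun p hp => (hT p hp.1).le) q
    rw [Real.norm_of_nonneg hnn]
    refine indicator_le_indicator_apply_of_nonneg ?_ (fun p hp => ?_) q
    · exact inter_subset_inter_right _ (Ioo_subset_Ioo_left (by linarith))
    · exact (hT p hp.1).le

theorem tendsto_truncatedSum_nhdsLT (hT : ∀ q ∈ Q, 0 < T q)
    (hsum : ∀ a < x₀, Summable fun q : ↥(Q ∩ Ioo a x₀) => T q.1) (y : ℝ) :
    Tendsto (truncatedSum x₀ Q T) (𝓝[<] y) (𝓝 (truncatedSum x₀ Q T y)) := by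
  rw [truncatedSum_eq_tsum_indicator y]
  have hlt : ∀ᶠ z in 𝓝[<] y, z < y := self_mem_nhdsWithin
  refine tendsto_truncatedSum_of_eventually_mem_iff hT hsum (hlt.mono fun _ => le_of_lt)
    fun q => ?_
  by_cases hq : x₀ - y < q
  · filter_upwards [mem_nhdsWithin_of_mem_nhds (Ioi_mem_nhds (show x₀ - q < y by linarith))]
      with z hz
    have h : x₀ - z < q := by linarith [mem_Ioi.1 hz]
    simp [hq, h]
  · filter_upwards [hlt] with z hz
    have h : ¬ x₀ - z < q := by linarith
    simp [hq, h]

theorem tendsto_truncatedSum_nhdsGT (hQ : Q ⊆ Iio x₀) (hT : ∀ q ∈ Q, 0 < T q)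
    (hsum : ∀ a < x₀, Summable fun q : ↥(Q ∩ Ioo a x₀) => T q.1) {q : ℝ} (hq : q ∈ Q) :
    Tendsto (truncatedSum x₀ Q T) (𝓝[>] (x₀ - q))
      (𝓝 (truncatedSum x₀ Q T (x₀ - q) + T q)) := by
  rw [add_comm, ← (hasSum_indicator_insert hsum q).tsum_eq]
  have hgt : ∀ᶠ z in 𝓝[>] (x₀ - q), x₀ - q < z := self_mem_nhdsWithin
  refine tendsto_truncatedSum_of_eventually_mem_iff (c := x₀ - q + 1) hT hsum ?_ fun p => ?_
  · filter_upwards [mem_nhdsWithin_of_mem_nhds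
      (Iio_mem_nhds (show x₀ - q < x₀ - q + 1 by linarith))] with z hz using le_of_lt hz
  · rcases lt_trichotomy p q with hp | rfl | hp
    · filter_upwards [mem_nhdsWithin_of_mem_nhds
        (Iio_mem_nhds (show x₀ - q < x₀ - p by linarith))] with z hz
      have h : ¬ x₀ - z < p := by linarith [mem_Iio.1 hz]
      simp [h, hp.ne, hp.not_gt]
    · filter_upwards [hgt] with z hz
      have h : x₀ - z < p := by linarith
      simpa [hq, h] using hQ hq
    · filter_upwards [hgt] with z hz
      have h : x₀ - z < p := by linarith
      simp [h, hp, hp.ne']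

end TruncatedSum

section RightInverse

open Filter Topology

variable {F : ℝ → ℝ}

/-- The level at which `F`, restricted to `[0, ∞)`, first exceeds `t`. -/
noncomputable def firstPassage (F : ℝ → ℝ) (t : ℝ) : ℝ := sInf {y | 0 ≤ y ∧ t < F y}

theorem bddBelow_passage (F : ℝ → ℝ) (t : ℝ) : BddBelow {y | 0 ≤ y ∧ t < F y} :=
  ⟨0, fun _ h => h.1⟩

theorem firstPassage_nonneg (F : ℝ → ℝ) (t : ℝ) : 0 ≤ firstPassage F t :=
  Real.sInf_nonneg fun _ h => h.1

theorem firstPassage_le {t y : ℝ} (hy : 0 ≤ y) (h : t < F y) : firstPassage F t ≤ y :=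
  csInf_le (bddBelow_passage F t) ⟨hy, h⟩

theorem le_firstPassage (hF : Monotone F) {t y : ℝ} (ht : ∃ z, 0 ≤ z ∧ t < F z)
    (h : F y ≤ t) : y ≤ firstPassage F t := by
  refine le_csInf ht fun z hz => ?_
  by_contra! hlt
  linarith [hF hlt.le, hz.2]

theorem lt_of_firstPassage_lt (hF : Monotone F) {t y : ℝ} (ht : ∃ z, 0 ≤ z ∧ t < F z)
    (h : firstPassage F t < y) : t < F y := by
  by_contra! hle
  exact (le_firstPassage hF ht hle).not_gt h

theorem firstPassage_mono {s t : ℝ} (hst : s ≤ t) (ht : ∃ z, 0 ≤ z ∧ t < F z) :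
    firstPassage F s ≤ firstPassage F t :=
  csInf_le_csInf (bddBelow_passage F s) ht fun _ h => ⟨h.1, hst.trans_lt h.2⟩

theorem apply_firstPassage_le (hF : ∀ y, Tendsto F (𝓝[<] y) (𝓝 (F y))) (hF0 : F 0 = 0)
    (hFm : Monotone F) {t : ℝ} (ht : 0 ≤ t) : F (firstPassage F t) ≤ t := by
  by_contra! h
  obtain ⟨z, hz, hzlt⟩ := (((hF _).eventually_const_lt h).and self_mem_nhdsWithin).exists
  have hz0 : 0 ≤ z := by
    by_contra! hneg
    linarith [hFm hneg.le]
  exact (firstPassage_le hz0 hz).not_gt hzlt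

theorem firstPassage_apply (hF : StrictMonoOn F (Ici 0)) {y : ℝ} (hy : 0 ≤ y) :
    firstPassage F (F y) = y := by
  have h : {z | 0 ≤ z ∧ F y < F z} = Ioi y := by
    ext z
    constructor
    · rintro ⟨hz, hlt⟩
      exact (hF.lt_iff_lt hy hz).1 hlt
    · exact fun hz => ⟨hy.trans (le_of_lt hz), hF hy (hy.trans (le_of_lt hz)) hz⟩
  rw [firstPassage, h, csInf_Ioi]

theorem continuousWithinAt_firstPassage (hFm : Monotone F) (hFs : StrictMonoOn F (Ici 0))
    {t : ℝ} (hle : F (firstPassage F t) ≤ t) (ht : ∃ z, 0 ≤ z ∧ t < F z) :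
    ContinuousWithinAt (firstPassage F) {s | 0 ≤ s ∧ ∃ z, 0 ≤ z ∧ s < F z} t := by
  refine tendsto_order.2 ⟨fun z hz => ?_, fun z hz => ?_⟩
  · rcases lt_or_ge z 0 with hz0 | hz0
    · exact Eventually.of_forall fun s => hz0.trans_le (firstPassage_nonneg F s)
    · obtain ⟨w, hzw, hw⟩ := exists_between hz
      have hwt : F w < t :=
        (hFs (hz0.trans hzw.le) (firstPassage_nonneg F t) hw).trans_le hle
      filter_upwards [mem_nhdsWithin_of_mem_nhds (Ioi_mem_nhds hwt), self_mem_nhdsWithin]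
        with s hs hsD
      exact hzw.trans_le (le_firstPassage hFm hsD.2 (le_of_lt hs))
  · obtain ⟨w, hw, hwz⟩ := exists_between hz
    filter_upwards [mem_nhdsWithin_of_mem_nhds
      (Iio_mem_nhds (lt_of_firstPassage_lt hFm ht hw))] with s hs
    exact (firstPassage_le ((firstPassage_nonneg F t).trans hw.le) hs).trans_lt hwz

end RightInverse

/-- The excursion `e` on `[0, L]`, started at time `b` and extended by its end values. -/
noncomputable def shiftedExcursion (e : ℝ → ℝ) (L b t : ℝ) : ℝ := e (max 0 (min L (t - b)))

theorem clamp_mem_Icc {L : ℝ} (hL : 0 ≤ L) (x : ℝ) : max 0 (min L x) ∈ Icc 0 L :=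
  ⟨le_max_left _ _, max_le hL (min_le_left _ _)⟩

theorem continuous_shiftedExcursion {e : ℝ → ℝ} {L : ℝ} (hL : 0 ≤ L)
    (he : ContinuousOn e (Icc 0 L)) (b : ℝ) : Continuous (shiftedExcursion e L b) :=
  he.comp_continuous (by fun_prop) fun _ => clamp_mem_Icc hL _

theorem shiftedExcursion_of_le {e : ℝ → ℝ} {L b t : ℝ} (h : t ≤ b) :
    shiftedExcursion e L b t = e 0 := by
  rw [shiftedExcursion, max_eq_left ((min_le_right _ _).trans (by linarith))]

theorem shiftedExcursion_of_ge {e : ℝ → ℝ} {L b t : ℝ} (hL : 0 ≤ L) (h : b + L ≤ t) :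
    shiftedExcursion e L b t = e L := by
  rw [shiftedExcursion, min_eq_left (by linarith), max_eq_right hL]

theorem shiftedExcursion_of_mem {e : ℝ → ℝ} {L b t : ℝ} (h₁ : b ≤ t) (h₂ : t ≤ b + L) :
    shiftedExcursion e L b t = e (t - b) := by
  rw [shiftedExcursion, min_eq_right (by linarith), max_eq_right (by linarith)]

/-- the path `ξ` obtained by glueing the excursions `q + e_q`, `q ∈ Q`,
ordered in the decreasing sense of their minima, is continuous on `[0, T_max)`, and its
running infimum on `[0, t]` is `θ(t)`. -/
theorem glued_path_continuous_and_runningInf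
    (x₀ : ℝ) (Q : Set ℝ) (hQsub : Q ⊆ Iio x₀) (hQcount : Q.Countable)
    (hQdense : Iio x₀ ⊆ closure Q)
    (T : ℝ → ℝ) (e : ℝ → ℝ → ℝ)
    (hTpos : ∀ q ∈ Q, 0 < T q)
    (hecont : ∀ q ∈ Q, ContinuousOn (e q) (Icc 0 (T q)))
    (he0 : ∀ q ∈ Q, e q 0 = 0)
    (heT : ∀ q ∈ Q, e q (T q) = 0)
    (hepos : ∀ q ∈ Q, ∀ t ∈ Ioo 0 (T q), 0 < e q t)
    (hbig : ∀ C : ℝ, 0 < C → ∀ a : ℝ, a < x₀ →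
      {q | q ∈ Q ∧ a < q ∧ ∃ t ∈ Icc 0 (T q), C < e q t}.Finite)
    (hsum : ∀ a : ℝ, a < x₀ → Summable fun q : ↥(Q ∩ Ioo a x₀) => T q.1)
    (𝒯 : ℝ → ℝ)
    (h𝒯 : ∀ y : ℝ, 𝒯 y = ∑' q : ↥(Q ∩ Ioo (x₀ - y) x₀), T q.1)
    (D : Set ℝ) (hD : D = {t : ℝ | 0 ≤ t ∧ ∃ y : ℝ, 0 ≤ y ∧ t < 𝒯 y})
    (θ : ℝ → ℝ) (hθ : ∀ t : ℝ, θ t = x₀ - sInf {y : ℝ | 0 ≤ y ∧ t < 𝒯 y})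
    (bminus : ℝ → ℝ)
    (hbminus : ∀ t : ℝ, bminus t = sInf {s : ℝ | s ∈ D ∧ θ s = θ t})
    (ξ : ℝ → ℝ)
    (hξQ : ∀ t ∈ D, θ t ∈ Q → ξ t = θ t + e (θ t) (t - bminus t))
    (hξnQ : ∀ t ∈ D, θ t ∉ Q → ξ t = θ t) :
    ContinuousOn ξ D ∧ ∀ t ∈ D, IsGLB (ξ '' Icc 0 t) (θ t) := by
  obtain rfl : 𝒯 = truncatedSum x₀ Q T := funext h𝒯
  subst hD
  set F := truncatedSum x₀ Q T with hF
  set D := {t : ℝ | 0 ≤ t ∧ ∃ y : ℝ, 0 ≤ y ∧ t < F y}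
  have hFm : Monotone F := truncatedSum_mono hTpos hsum
  have hFs : StrictMonoOn F (Ici 0) := truncatedSum_strictMonoOn hQsub hQdense hTpos hsum
  have hF0 : F 0 = 0 := by simp [hF, truncatedSum_eq_tsum_indicator]
  have hFnn : ∀ y, 0 ≤ F y := truncatedSum_nonneg hTpos
  have hle : ∀ t, 0 ≤ t → F (firstPassage F t) ≤ t := fun t ht =>
    apply_firstPassage_le (tendsto_truncatedSum_nhdsLT hTpos hsum) hF0 hFm ht
  replace hθ : ∀ t, θ t = x₀ - firstPassage F t := hθ
  have hθ' : ∀ t, x₀ - θ t = firstPassage F t := fun t => by rw [hθ]; ring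
  have hFD : ∀ y, 0 ≤ y → F y ∈ D := fun y hy =>
    ⟨hFnn y, y + 1, by linarith, hFs hy (by simp only [mem_Ici]; linarith) (by linarith)⟩
  have hθF : ∀ t, θ (F (firstPassage F t)) = θ t := fun t => by
    rw [hθ, hθ, firstPassage_apply hFs (firstPassage_nonneg F t)]
  have hb : ∀ t, bminus t = F (firstPassage F t) := by
    intro t
    rw [hbminus]
    refine IsLeast.csInf_eq ⟨⟨hFD _ (firstPassage_nonneg F t), hθF t⟩, ?_⟩
    rintro s ⟨hs, hst⟩
    rw [← hθ' t, ← hst, hθ' s]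
    exact hle s hs.1
  have hexc : ∀ t ∈ D, θ t ∈ Q → t ≤ F (firstPassage F t) + T (θ t) := by
    intro t ht hq
    have h := tendsto_truncatedSum_nhdsGT hQsub hTpos hsum hq
    rw [← hθ' t]
    refine ge_of_tendsto h ?_
    filter_upwards [self_mem_nhdsWithin] with z hz
    rw [hθ'] at hz
    exact (lt_of_firstPassage_lt hFm ht.2 hz).le
  have henn : ∀ q ∈ Q, ∀ t ∈ Icc 0 (T q), 0 ≤ e q t := by
    intro q hq t ht
    rcases ht.1.eq_or_lt with h | h
    · rw [← h, he0 q hq]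
    rcases ht.2.eq_or_lt with h' | h'
    · rw [h', heT q hq]
    exact (hepos q hq t ⟨h, h'⟩).le
  let f : ℝ → ℝ → ℝ := fun q => shiftedExcursion (e q) (T q) (F (x₀ - q))
  have hfcont : ∀ q ∈ Q, Continuous (f q) := fun q hq =>
    continuous_shiftedExcursion (hTpos q hq).le (hecont q hq) _
  have hf_ne : ∀ q ∈ Q, ∀ t ∈ D, q ≠ θ t → f q t = 0 := by
    intro q hq t ht hne
    rcases hne.lt_or_gt with h | h
    · have h' : firstPassage F t < x₀ - q := by linarith [hθ t]
      exact (shiftedExcursion_of_le (lt_of_firstPassage_lt hFm ht.2 h').le).trans (he0 q hq)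
    · have h' : x₀ - q < firstPassage F t := by linarith [hθ t]
      have := truncatedSum_add_le hQsub hTpos hsum hq h'
      exact (shiftedExcursion_of_ge (hTpos q hq).le (this.trans (hle t ht.1))).trans (heT q hq)
  have hξf : ∀ t ∈ D, θ t ∈ Q → ξ t = θ t + f (θ t) t := by
    intro t ht hq
    rw [hξQ t ht hq, hb]
    simp only [f]
    rw [hθ', shiftedExcursion_of_mem (hle t ht.1) (hexc t ht hq)]
  have hfnn : ∀ q ∈ Q, ∀ t, 0 ≤ f q t := fun q hq t =>
    henn q hq _ (clamp_mem_Icc (hTpos q hq).le _)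
  have hθcont : ContinuousOn θ D := by
    rw [funext hθ]
    exact fun t ht => continuousWithinAt_const.sub
      (continuousWithinAt_firstPassage hFm hFs (hle t ht.1) ht.2)
  have hξge : ∀ t ∈ D, θ t ≤ ξ t := by
    intro t ht
    by_cases hq : θ t ∈ Q
    · linarith [hξf t ht hq, hfnn _ hq t]
    · exact (hξnQ t ht hq).ge
  refine ⟨fun t ht => ?_, fun t ht => ⟨?_, fun c hc => ?_⟩⟩
  · refine continuousWithinAt_of_locally_uniform_approx_of_continuousWithinAt ht fun u hu => ?_
    obtain ⟨ε, hε, hεu⟩ := Metric.mem_uniformity_dist.1 hu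
    have ha : θ t - 1 < x₀ := by linarith [hθ t, firstPassage_nonneg F t]
    set G := (hbig (ε / 2) (half_pos hε) (θ t - 1) ha).toFinset
    have hGQ : ∀ q ∈ G, q ∈ Q := fun q hq => ((Set.Finite.mem_toFinset _).1 hq).1
    refine ⟨_, (hθcont t ht).eventually_const_lt (sub_one_lt (θ t)) |>.and self_mem_nhdsWithin,
      fun s => θ s + ∑ q ∈ G, f q s, ?_, ?_⟩
    · exact (hθcont t ht).add (tendsto_finsetSum _ fun q hq =>
        (hfcont q (hGQ q hq)).continuousWithinAt)
    · rintro s ⟨hs, hsD⟩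
      apply hεu
      rw [Real.dist_eq]
      beta_reduce
      by_cases hsG : θ s ∈ G
      · rw [Finset.sum_eq_single_of_mem _ hsG
          fun q hq hne => hf_ne q (hGQ q hq) s hsD hne, hξf s hsD (hGQ _ hsG)]
        simpa using hε
      · rw [Finset.sum_eq_zero fun q hq => hf_ne q (hGQ q hq) s hsD
          (ne_of_mem_of_not_mem hq hsG)]
        by_cases hq : θ s ∈ Q
        · have hfle : f (θ s) s ≤ ε / 2 := by
            by_contra! hlt
            exact hsG ((Set.Finite.mem_toFinset _).2
              ⟨hq, hs, _, clamp_mem_Icc (hTpos _ hq).le _, hlt⟩)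
          rw [hξf s hsD hq, add_zero, add_sub_cancel_left, abs_of_nonneg (hfnn _ hq s)]
          linarith
        · rw [hξnQ s hsD hq]
          simpa using hε
  · rintro _ ⟨s, hs, rfl⟩
    obtain ⟨-, z, hz, htz⟩ := ht
    have hsD : s ∈ D := ⟨hs.1, z, hz, hs.2.trans_lt htz⟩
    refine le_trans ?_ (hξge s hsD)
    rw [hθ, hθ]
    linarith [firstPassage_mono hs.2 ⟨z, hz, htz⟩]
  · set s := F (firstPassage F t) with hs
    have hsD : s ∈ D := hFD _ (firstPassage_nonneg F t)
    have hsξ : ξ s = θ t := by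
      by_cases hq : θ s ∈ Q
      · rw [hξQ s hsD hq, hb, firstPassage_apply hFs (firstPassage_nonneg F t), ← hs, sub_self,
          he0 _ hq, add_zero, hθF]
      · rw [hξnQ s hsD hq, hθF]
    exact hsξ ▸ hc ⟨s, ⟨hsD.1, hle t ht.1⟩, rfl⟩
end

section
/- With the glueing construction below, let 𝔟⁻ := { t ∈ [0,T_max) : θ(t) ∈ Q and b⁻(t) = t }. Then 𝔟⁻ = { t ∈ [0,T_max) : ξ(t) = inf_{s∈[0,t]} ξ(s) and there exists ε > 0 such that ξ(t+s) > ξ(t) for every s ∈ (0, ε) with t + s < T_max }. Moreover, for every t₀ ∈ 𝔟⁻, b⁺(t₀) = inf{ t ∈ [t₀, T_max) : ξ(t) < ξ(t₀) }, with the convention that the infimum of the empty set is T_max. -/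
open Set Filter Topology

theorem eventually_indicator_Ioo_eq_of_nhdsGT (g : ℝ → ℝ) (a b x : ℝ) :
    ∀ᶠ a' in 𝓝[>] a, (Ioo a' b).indicator g x = (Ioo a b).indicator g x := by
  rcases le_or_gt x a with hx | hx
  · filter_upwards [self_mem_nhdsWithin] with a' ha'
    rw [indicator_of_notMem fun h => (hx.trans_lt ha').not_gt h.1,
      indicator_of_notMem fun h => hx.not_gt h.1]
  · filter_upwards [mem_nhdsWithin_of_mem_nhds (Iio_mem_nhds hx)] with a' ha'
    have : x ∈ Ioo a' b ↔ x ∈ Ioo a b := ⟨fun h => ⟨hx, h.2⟩, fun h => ⟨ha', h.2⟩⟩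
    by_cases h : x ∈ Ioo a b <;> simp only [indicator, this, h, if_true, if_false]

theorem eventually_indicator_Ioo_eq_Ico_of_nhdsLT (g : ℝ → ℝ) (a b x : ℝ) :
    ∀ᶠ a' in 𝓝[<] a, (Ioo a' b).indicator g x = (Ico a b).indicator g x := by
  rcases lt_or_ge x a with hx | hx
  · filter_upwards [mem_nhdsWithin_of_mem_nhds (Ioi_mem_nhds hx)] with a' ha'
    rw [indicator_of_notMem fun h => (h.1.trans ha').false,
      indicator_of_notMem fun h => hx.not_ge h.1]
  · filter_upwards [self_mem_nhdsWithin] with a' ha'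
    have : x ∈ Ioo a' b ↔ x ∈ Ico a b :=
      ⟨fun h => ⟨hx, h.2⟩, fun h => ⟨lt_of_lt_of_le ha' hx, h.2⟩⟩
    by_cases h : x ∈ Ico a b <;> simp only [indicator, this, h, if_true, if_false]

theorem tendsto_tsum_indicator_Ioo_nhdsGT {g : ℝ → ℝ} (hg : ∀ x, 0 ≤ g x) {a b : ℝ}
    (hs : Summable ((Ioo a b).indicator g)) :
    Tendsto (fun a' => ∑' x, (Ioo a' b).indicator g x) (𝓝[>] a)
      (𝓝 (∑' x, (Ioo a b).indicator g x)) := by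
  refine tendsto_tsum_of_dominated_convergence hs (fun x => ?_) ?_
  · exact tendsto_const_nhds.congr'
      ((eventually_indicator_Ioo_eq_of_nhdsGT g a b x).mono fun _ h => h.symm)
  · filter_upwards [self_mem_nhdsWithin] with a' ha' x
    rw [Real.norm_of_nonneg (indicator_nonneg (fun x _ => hg x) x)]
    exact indicator_le_indicator_of_subset (Ioo_subset_Ioo_left (le_of_lt ha')) hg x

theorem tendsto_tsum_indicator_Ioo_nhdsLT {g : ℝ → ℝ} (hg : ∀ x, 0 ≤ g x) {a b c : ℝ}
    (hc : c < a) (hs : Summable ((Ioo c b).indicator g)) :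
    Tendsto (fun a' => ∑' x, (Ioo a' b).indicator g x) (𝓝[<] a)
      (𝓝 (∑' x, (Ico a b).indicator g x)) := by
  refine tendsto_tsum_of_dominated_convergence hs (fun x => ?_) ?_
  · exact tendsto_const_nhds.congr'
      ((eventually_indicator_Ioo_eq_Ico_of_nhdsLT g a b x).mono fun _ h => h.symm)
  · filter_upwards [mem_nhdsWithin_of_mem_nhds (Ioi_mem_nhds hc)] with a' ha' x
    rw [Real.norm_of_nonneg (indicator_nonneg (fun x _ => hg x) x)]
    exact indicator_le_indicator_of_subset (Ioo_subset_Ioo_left (le_of_lt ha')) hg x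

theorem tsum_indicator_Ico_eq {g : ℝ → ℝ} {a b : ℝ} (hab : a ≤ b) (hb : g b = 0)
    (hs : Summable ((Ioo a b).indicator g)) :
    ∑' x, (Ico a b).indicator g x = ∑' x, (Ioo a b).indicator g x + g a := by
  rcases hab.eq_or_lt with rfl | hab
  · simp [hb]
  · have h : (Ico a b).indicator g =
        fun x => (Ioo a b).indicator g x + ({a} : Set ℝ).indicator g x := by
      rw [← Ioo_union_left hab, indicator_union_of_disjoint (by simp)]
    have ha : HasSum (({a} : Set ℝ).indicator g) (g a) := by
      convert hasSum_single a fun x hx => indicator_of_notMem (s := {a}) (f := g) hx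
      simp
    rw [h, hs.tsum_add ha.summable, ha.tsum_eq]

/-- The properties of `𝒯` that determine its right-continuous inverse:
`g y` is the jump of the left-continuous function `𝒯` at `y`. -/
structure IsJumpFunction (𝒯 g : ℝ → ℝ) : Prop where
  zero : 𝒯 0 = 0
  jump_nonneg : ∀ y, 0 ≤ g y
  jump_lt : ∀ {y z}, 0 ≤ y → y < z → 𝒯 y + g y < 𝒯 z
  left_cont : ∀ {t y}, 0 ≤ t → t < 𝒯 y → ∃ w, 0 ≤ w ∧ w < y ∧ t < 𝒯 w
  right_lim : ∀ {y c}, 0 ≤ y → 𝒯 y + g y < c → ∃ z, y < z ∧ 𝒯 z < c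

/-- The right-continuous inverse of `𝒯` on `[0, ∞)`. -/
noncomputable def rightInverse (𝒯 : ℝ → ℝ) (t : ℝ) : ℝ := sInf {y : ℝ | 0 ≤ y ∧ t < 𝒯 y}

theorem rightInverse_nonneg (𝒯 : ℝ → ℝ) (t : ℝ) : 0 ≤ rightInverse 𝒯 t :=
  Real.sInf_nonneg fun _ h => h.1

theorem rightInverse_mono {𝒯 : ℝ → ℝ} {s t : ℝ} (hD : ∃ z : ℝ, 0 ≤ z ∧ t < 𝒯 z)
    (hst : s ≤ t) : rightInverse 𝒯 s ≤ rightInverse 𝒯 t :=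
  csInf_le_csInf ⟨0, fun _ h => h.1⟩ hD fun _ hy => ⟨hy.1, hst.trans_lt hy.2⟩

namespace IsJumpFunction

variable {𝒯 g : ℝ → ℝ} {t y z : ℝ}

theorem lt (h : IsJumpFunction 𝒯 g) (hy : 0 ≤ y) (hyz : y < z) : 𝒯 y < 𝒯 z :=
  (le_add_of_nonneg_right (h.jump_nonneg y)).trans_lt (h.jump_lt hy hyz)

theorem mono (h : IsJumpFunction 𝒯 g) (hy : 0 ≤ y) (hyz : y ≤ z) : 𝒯 y ≤ 𝒯 z :=
  hyz.eq_or_lt.elim (fun e => e ▸ le_rfl) fun e => (h.lt hy e).le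

theorem nonneg (h : IsJumpFunction 𝒯 g) (hy : 0 ≤ y) : 0 ≤ 𝒯 y := h.zero ▸ h.mono le_rfl hy

theorem rightInverse_eq (h : IsJumpFunction 𝒯 g) (hy : 0 ≤ y)
    (ht : t ∈ Icc (𝒯 y) (𝒯 y + g y)) :
    rightInverse 𝒯 t = y := by
  have : {z : ℝ | 0 ≤ z ∧ t < 𝒯 z} = Ioi y := by
    ext z
    refine ⟨fun hz => ?_, fun hz => ⟨hy.trans (le_of_lt hz), ht.2.trans_lt (h.jump_lt hy hz)⟩⟩
    by_contra hn
    exact (hz.2.trans_le (h.mono hz.1 (not_lt.1 hn))).not_ge ht.1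
  rw [rightInverse, this, csInf_Ioi]

theorem mem_domain (h : IsJumpFunction 𝒯 g) (hy : 0 ≤ y) (ht : t ∈ Icc (𝒯 y) (𝒯 y + g y)) :
    0 ≤ t ∧ ∃ z : ℝ, 0 ≤ z ∧ t < 𝒯 z :=
  ⟨(h.nonneg hy).trans ht.1, y + 1, by linarith, ht.2.trans_lt (h.jump_lt hy (by linarith))⟩

theorem mem_Icc_rightInverse (h : IsJumpFunction 𝒯 g) (ht : 0 ≤ t)
    (hD : ∃ z : ℝ, 0 ≤ z ∧ t < 𝒯 z) :
    t ∈ Icc (𝒯 (rightInverse 𝒯 t)) (𝒯 (rightInverse 𝒯 t) + g (rightInverse 𝒯 t)) := by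
  have hbdd : BddBelow {y : ℝ | 0 ≤ y ∧ t < 𝒯 y} := ⟨0, fun _ h => h.1⟩
  constructor <;> by_contra! hlt
  · obtain ⟨w, hw0, hwy, hw⟩ := h.left_cont ht hlt
    exact (csInf_le hbdd ⟨hw0, hw⟩).not_gt hwy
  · obtain ⟨z, hz, hzt⟩ := h.right_lim (rightInverse_nonneg 𝒯 t) hlt
    refine (le_csInf (a := z) hD fun y hy => ?_).not_gt hz
    by_contra! hyz
    exact (hy.2.trans_le (h.mono hy.1 hyz.le)).not_gt hzt

theorem level_set_eq (h : IsJumpFunction 𝒯 g) (hy : 0 ≤ y) :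
    {s : ℝ | (0 ≤ s ∧ ∃ z : ℝ, 0 ≤ z ∧ s < 𝒯 z) ∧ rightInverse 𝒯 s = y} =
      Icc (𝒯 y) (𝒯 y + g y) := by
  ext s
  refine ⟨?_, fun hs => ⟨h.mem_domain hy hs, h.rightInverse_eq hy hs⟩⟩
  rintro ⟨⟨hs, hD⟩, rfl⟩
  exact h.mem_Icc_rightInverse hs hD

end IsJumpFunction

/-- The total length of the excursions with minimum above `x₀ - y` is a jump function of the
depth `y`, with jump `T (x₀ - y)` when `x₀ - y ∈ Q`. -/
theorem isJumpFunction_tsum {x₀ : ℝ} {Q : Set ℝ} (hQsub : Q ⊆ Iio x₀)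
    (hQdense : Iio x₀ ⊆ closure Q) {T : ℝ → ℝ} (hTpos : ∀ q ∈ Q, 0 < T q)
    (hsum : ∀ a : ℝ, a < x₀ → Summable fun q : ↥(Q ∩ Ioo a x₀) => T q.1)
    {𝒯 : ℝ → ℝ} (h𝒯 : ∀ y : ℝ, 𝒯 y = ∑' q : ↥(Q ∩ Ioo (x₀ - y) x₀), T q.1) :
    IsJumpFunction 𝒯 fun y => Q.indicator T (x₀ - y) := by
  set g := Q.indicator T with hg
  have hg0 : ∀ x, 0 ≤ g x := indicator_nonneg fun q hq => (hTpos q hq).le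
  have hgx : g x₀ = 0 := indicator_of_notMem (fun hx => lt_irrefl x₀ (hQsub hx)) _
  have hind : ∀ a, (Ioo a x₀).indicator g = (Q ∩ Ioo a x₀).indicator T := fun a => by
    rw [hg, indicator_indicator, inter_comm]
  have hs : ∀ a, Summable ((Ioo a x₀).indicator g) := fun a => by
    rcases lt_or_ge a x₀ with ha | ha
    · rw [hind]
      exact summable_subtype_iff_indicator.1 (hsum a ha)
    · rw [Ioo_eq_empty ha.not_gt, indicator_empty]
      exact summable_zero
  have h𝒯' : ∀ y, 𝒯 y = ∑' x, (Ioo (x₀ - y) x₀).indicator g x := fun y => by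
    rw [h𝒯, hind, tsum_subtype]
  refine ⟨?_, fun y => hg0 _, ?_, ?_, ?_⟩
  · simp [h𝒯']
  · intro y z hy hyz
    obtain ⟨q, ⟨hzq, hqy⟩, hq⟩ := mem_closure_iff.1
      (hQdense (show x₀ - (y + z) / 2 < x₀ by linarith)) (Ioo (x₀ - z) (x₀ - y)) isOpen_Ioo
      ⟨by linarith, by linarith⟩
    have hqx : q < x₀ := hQsub hq
    have hIco : Summable ((Ico (x₀ - y) x₀).indicator g) := by
      refine (hs (x₀ - z)).of_nonneg_of_le (indicator_nonneg fun x _ => hg0 x) ?_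
      exact indicator_le_indicator_of_subset
        (fun x hx => ⟨by linarith [hx.1], hx.2⟩) hg0
    have hgq : g q = T q := indicator_of_mem hq T
    rw [h𝒯', h𝒯', ← tsum_indicator_Ico_eq (by linarith) hgx (hs _)]
    refine hIco.tsum_lt_tsum (i := q) ?_ ?_ (hs _)
    · exact indicator_le_indicator_of_subset
        (show Ico (x₀ - y) x₀ ⊆ Ioo (x₀ - z) x₀ from fun x hx => ⟨by linarith [hx.1], hx.2⟩) hg0
    · rw [indicator_of_notMem fun h => h.1.not_gt hqy,
        indicator_of_mem (show q ∈ Ioo (x₀ - z) x₀ from ⟨hzq, hqx⟩), hgq]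
      exact hTpos q hq
  · intro t y ht hty
    have hlim := (tendsto_tsum_indicator_Ioo_nhdsGT hg0 (hs (x₀ - y))).eventually
      (lt_mem_nhds (h𝒯' y ▸ hty))
    obtain ⟨a, hat, ha⟩ := (hlim.and self_mem_nhdsWithin).exists
    refine ⟨x₀ - a, ?_, ?_, ?_⟩
    · by_contra! hlt
      rw [Ioo_eq_empty (by linarith)] at hat
      simp at hat
      linarith
    · linarith [show x₀ - y < a from ha]
    · rwa [h𝒯', sub_sub_cancel]
  · intro y c hy hc
    rw [h𝒯', ← tsum_indicator_Ico_eq (by linarith) hgx (hs _)] at hc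
    have hlim := (tendsto_tsum_indicator_Ioo_nhdsLT hg0 (sub_one_lt (x₀ - y)) (hs _)).eventually
      (gt_mem_nhds hc)
    obtain ⟨a, hac, ha⟩ := (hlim.and self_mem_nhdsWithin).exists
    refine ⟨x₀ - a, by linarith [show a < x₀ - y from ha], ?_⟩
    rwa [h𝒯', sub_sub_cancel]

/-- for the path `ξ` obtained by glueing the excursions `q + e_q`,
`q ∈ Q`, ordered in the decreasing sense of their minima, the set
`𝔟⁻ = {t : θ(t) ∈ Q, b⁻(t) = t}` of left endpoints of excursion intervals is
recovered from `ξ`, and for `t₀ ∈ 𝔟⁻`, `b⁺(t₀) = inf {t ∈ [t₀, T_max) : ξ(t) < ξ(t₀)}`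
(with the convention `inf ∅ = T_max`, i.e. the supremum of the domain). -/
theorem glued_path_excursion_endpoints
    (x₀ : ℝ) (Q : Set ℝ) (hQsub : Q ⊆ Iio x₀) (hQcount : Q.Countable)
    (hQdense : Iio x₀ ⊆ closure Q)
    (T : ℝ → ℝ) (e : ℝ → ℝ → ℝ)
    (hTpos : ∀ q ∈ Q, 0 < T q)
    (hecont : ∀ q ∈ Q, ContinuousOn (e q) (Icc 0 (T q)))
    (he0 : ∀ q ∈ Q, e q 0 = 0)
    (heT : ∀ q ∈ Q, e q (T q) = 0)
    (hepos : ∀ q ∈ Q, ∀ t ∈ Ioo 0 (T q), 0 < e q t)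
    (hbig : ∀ C : ℝ, 0 < C → ∀ a : ℝ, a < x₀ →
      {q | q ∈ Q ∧ a < q ∧ ∃ t ∈ Icc 0 (T q), C < e q t}.Finite)
    (hsum : ∀ a : ℝ, a < x₀ → Summable fun q : ↥(Q ∩ Ioo a x₀) => T q.1)
    (𝒯 : ℝ → ℝ)
    (h𝒯 : ∀ y : ℝ, 𝒯 y = ∑' q : ↥(Q ∩ Ioo (x₀ - y) x₀), T q.1)
    (D : Set ℝ) (hD : D = {t : ℝ | 0 ≤ t ∧ ∃ y : ℝ, 0 ≤ y ∧ t < 𝒯 y})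
    (θ : ℝ → ℝ) (hθ : ∀ t : ℝ, θ t = x₀ - sInf {y : ℝ | 0 ≤ y ∧ t < 𝒯 y})
    (bminus : ℝ → ℝ)
    (hbminus : ∀ t : ℝ, bminus t = sInf {s : ℝ | s ∈ D ∧ θ s = θ t})
    (bplus : ℝ → ℝ)
    (hbplus : ∀ t : ℝ, bplus t = sSup {s : ℝ | s ∈ D ∧ θ s = θ t})
    (ξ : ℝ → ℝ)
    (hξQ : ∀ t ∈ D, θ t ∈ Q → ξ t = θ t + e (θ t) (t - bminus t))
    (hξnQ : ∀ t ∈ D, θ t ∉ Q → ξ t = θ t) :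
    ({t : ℝ | t ∈ D ∧ θ t ∈ Q ∧ bminus t = t} =
      {t : ℝ | t ∈ D ∧ (∀ s ∈ Icc 0 t, ξ t ≤ ξ s) ∧
        ∃ ε : ℝ, 0 < ε ∧ ∀ s ∈ Ioo 0 ε, t + s ∈ D → ξ t < ξ (t + s)}) ∧
    ∀ t₀ ∈ D, θ t₀ ∈ Q → bminus t₀ = t₀ →
      (({t : ℝ | t ∈ D ∧ t₀ ≤ t ∧ ξ t < ξ t₀}).Nonempty →
        IsGLB {t : ℝ | t ∈ D ∧ t₀ ≤ t ∧ ξ t < ξ t₀} (bplus t₀)) ∧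
      ({t : ℝ | t ∈ D ∧ t₀ ≤ t ∧ ξ t < ξ t₀} = ∅ → IsLUB D (bplus t₀)) := by
  have hJ := isJumpFunction_tsum hQsub hQdense hTpos hsum h𝒯
  replace hθ : ∀ t, θ t = x₀ - rightInverse 𝒯 t := hθ
  have hy0 := rightInverse_nonneg 𝒯
  have hmem : ∀ {t}, t ∈ D ↔ 0 ≤ t ∧ ∃ y : ℝ, 0 ≤ y ∧ t < 𝒯 y := by simp [hD]
  have hlevel : ∀ t, {s : ℝ | s ∈ D ∧ θ s = θ t} =
      Icc (𝒯 (rightInverse 𝒯 t)) (𝒯 (rightInverse 𝒯 t) + Q.indicator T (θ t)) := fun t => by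
    rw [hθ t, ← hJ.level_set_eq (hy0 t)]
    simp [hmem, hθ]
  have hjump : ∀ t, 0 ≤ Q.indicator T (θ t) := fun t =>
    indicator_nonneg (fun q hq => (hTpos q hq).le) _
  have hbm : ∀ t, bminus t = 𝒯 (rightInverse 𝒯 t) := fun t => by
    rw [hbminus, hlevel, csInf_Icc (by linarith [hjump t])]
  have hbp : ∀ t, bplus t = bminus t + Q.indicator T (θ t) := fun t => by
    rw [hbplus, hlevel, csSup_Icc (by linarith [hjump t]), hbm]
  have hIcc : ∀ {s t}, s ∈ D ∧ θ s = θ t ↔ s ∈ Icc (bminus t) (bplus t) := fun {s t} => by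
    rw [hbp, hbm, ← hlevel, mem_ofPred_eq]
  have hbm_congr : ∀ {s t}, θ s = θ t → bminus s = bminus t := fun {s t} hst => by
    rw [hbminus, hbminus, hst]
  have hbpQ : ∀ {t}, θ t ∈ Q → bplus t = bminus t + T (θ t) := fun {t} ht => by
    rw [hbp, indicator_of_mem ht]
  have hanti : ∀ {s t}, t ∈ D → s ≤ t → θ t ≤ θ s := fun {s t} ht hst => by
    rw [hθ, hθ]
    linarith [rightInverse_mono (hmem.1 ht).2 hst]
  have hDle : ∀ {s t}, t ∈ D → 0 ≤ s → s ≤ t → s ∈ D := fun ht hs hst => by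
    obtain ⟨-, y, hy, hty⟩ := hmem.1 ht
    exact hmem.2 ⟨hs, y, hy, hst.trans_lt hty⟩
  have hξθ : ∀ t ∈ D, θ t ≤ ξ t := fun t ht => by
    by_cases hq : θ t ∈ Q
    · have hI := hIcc.1 ⟨ht, rfl⟩
      rw [hbpQ hq] at hI
      rw [hξQ t ht hq]
      refine le_add_of_nonneg_right ?_
      rcases hI.1.eq_or_lt with h | h
      · rw [h, sub_self, he0 _ hq]
      rcases hI.2.eq_or_lt with h' | h'
      · rw [show t - bminus t = T (θ t) by linarith, heT _ hq]
      · exact (hepos _ hq _ ⟨by linarith, by linarith⟩).le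
    · exact (hξnQ t ht hq).ge
  have hξm : ∀ t ∈ D, bminus t = t → ξ t = θ t := fun t ht hb => by
    by_cases hq : θ t ∈ Q
    · rw [hξQ t ht hq, hb, sub_self, he0 _ hq, add_zero]
    · exact hξnQ t ht hq
  have hξin : ∀ t ∈ D, θ t ∈ Q → bminus t < t → t < bplus t → θ t < ξ t :=
    fun t ht hq h1 h2 => by
      rw [hbpQ hq] at h2
      rw [hξQ t ht hq]
      linarith [hepos _ hq (t - bminus t) ⟨by linarith, by linarith⟩]
  have hbelow : ∀ t ∈ D, ∀ c, bplus t < c → ∃ s ∈ D, bplus t < s ∧ s < c ∧ ξ s < θ t :=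
    fun t _ c hc => by
      rw [hbp, hbm, hθ] at hc
      obtain ⟨z, hz, hzc⟩ := hJ.right_lim (hy0 t) hc
      obtain ⟨q, ⟨hq1, hq2⟩, hq⟩ := mem_closure_iff.1
        (hQdense (show x₀ - (rightInverse 𝒯 t + z) / 2 < x₀ by linarith [hy0 t]))
        (Ioo (x₀ - z) (x₀ - rightInverse 𝒯 t)) isOpen_Ioo ⟨by linarith, by linarith⟩
      have hw0 : 0 ≤ x₀ - q := by linarith [hy0 t]
      have hsI : 𝒯 (x₀ - q) ∈ Icc (𝒯 (x₀ - q)) (𝒯 (x₀ - q) + Q.indicator T (x₀ - (x₀ - q))) :=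
        ⟨le_rfl, le_add_of_nonneg_right (hJ.jump_nonneg (x₀ - q))⟩
      have hs := hJ.rightInverse_eq hw0 hsI
      have hsD : 𝒯 (x₀ - q) ∈ D := hmem.2 (hJ.mem_domain hw0 hsI)
      refine ⟨𝒯 (x₀ - q), hsD, ?_, ?_, ?_⟩
      · rw [hbp, hbm, hθ]
        exact hJ.jump_lt (hy0 t) (by linarith)
      · exact (hJ.lt hw0 (by linarith)).trans hzc
      · rw [hξm _ hsD (by rw [hbm, hs]), hθ, hθ, hs]
        linarith
  refine ⟨?_, ?_⟩
  · ext t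
    constructor
    · rintro ⟨ht, hq, hb⟩
      refine ⟨ht, fun s hs => ?_, T (θ t), hTpos _ hq, fun s hs hts => ?_⟩
      · rw [hξm t ht hb]
        exact (hanti ht hs.2).trans (hξθ s (hDle ht hs.1 hs.2))
      · obtain ⟨-, hθs⟩ := (hIcc (t := t)).2
          (show t + s ∈ Icc (bminus t) (bplus t) by
            rw [hbpQ hq, hb]; exact ⟨by linarith [hs.1], by linarith [hs.2]⟩)
        have hbs := hbm_congr hθs
        rw [hξm t ht hb, ← hθs]
        refine hξin _ hts (hθs ▸ hq) ?_ ?_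
        · linarith [hs.1]
        · rw [hbpQ (hθs ▸ hq), hbs, hb, hθs]
          linarith [hs.2]
    · rintro ⟨ht, hmin, ε, hε, hinc⟩
      have hI := hIcc.1 ⟨ht, rfl⟩
      have hne : t ≠ bplus t := fun hbt => by
        obtain ⟨s, hsD, h1, h2, hs⟩ := hbelow t ht (t + ε) (by linarith)
        have := hinc (s - t) ⟨by linarith, by linarith⟩ (by rwa [add_sub_cancel])
        rw [add_sub_cancel] at this
        linarith [hξθ t ht]
      have hlt := lt_of_le_of_ne hI.2 hne
      have hq : θ t ∈ Q := by
        by_contra hq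
        rw [hbp, indicator_of_notMem hq] at hlt
        linarith [hI.1]
      refine ⟨ht, hq, hI.1.eq_or_lt.resolve_right fun hb => ?_⟩
      obtain ⟨hmD, hmθ⟩ := (hIcc (t := t)).2 ⟨le_rfl, hI.1.trans hI.2⟩
      have := hmin _ ⟨(hmem.1 hmD).1, hI.1⟩
      rw [hξm _ hmD (hbm_congr hmθ), hmθ] at this
      exact this.not_gt (hξin t ht hq hb hlt)
  · intro t₀ ht₀ hq hb
    have hξ₀ := hξm t₀ ht₀ hb
    have hI := hIcc.1 ⟨ht₀, rfl⟩
    refine ⟨fun _ => ⟨?_, fun c hc => ?_⟩, fun hempty => ?_⟩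
    · rintro t ⟨ht, h0, hlt⟩
      by_contra! hcon
      obtain ⟨-, hθt⟩ := (hIcc (t := t₀)).2 ⟨hI.1.trans h0, hcon.le⟩
      linarith [hξθ t ht]
    · by_contra! hcon
      obtain ⟨s, hsD, h1, h2, hs⟩ := hbelow t₀ ht₀ c hcon
      exact (hc ⟨hsD, hI.2.trans h1.le, hξ₀ ▸ hs⟩).not_gt h2
    · obtain ⟨s, hsD, h1, -, hs⟩ := hbelow t₀ ht₀ _ (lt_add_one _)
      exact absurd (show s ∈ {t : ℝ | t ∈ D ∧ t₀ ≤ t ∧ ξ t < ξ t₀} from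
        ⟨hsD, hI.2.trans h1.le, hξ₀ ▸ hs⟩) (by rw [hempty]; exact notMem_empty s)
end

section
/- Let T ∈ (0, +∞] and let ξ : [0, T) → ℝ be any continuous function. Then the set { t ∈ [0,T) : ξ(t) = inf_{s∈[0,t]} ξ(s) and there exists ε > 0 such that ξ(t+s) > ξ(t) for every s ∈ (0, ε) with t + s < T } is countable. -/
open Set

/-- for any continuous function `ξ` on `[0, T)` (with `T ∈ (0, +∞]`),
the set of times at which `ξ` attains its running infimum and from which `ξ` stays
strictly above this value on a right-neighbourhood is countable. -/
theorem countable_left_endpoints_of_running_inf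
    (T : ENNReal) (hT : 0 < T) (ξ : ℝ → ℝ)
    (hcont : ContinuousOn ξ {t : ℝ | 0 ≤ t ∧ ENNReal.ofReal t < T}) :
    Set.Countable {t : ℝ | (0 ≤ t ∧ ENNReal.ofReal t < T) ∧
      (∀ s : ℝ, 0 ≤ s → s ≤ t → ξ t ≤ ξ s) ∧
      ∃ ε : ℝ, 0 < ε ∧ ∀ s ∈ Ioo (0 : ℝ) ε,
        ENNReal.ofReal (t + s) < T → ξ t < ξ (t + s)} := by
  refine countable_setOfPred_isolated_right_within.mono
    fun t ht => mem_sep ht (Filter.empty_mem_iff_bot.mp ?_)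
  obtain ⟨⟨ht0, -⟩, -, ε, hε, h⟩ := ht
  filter_upwards [self_mem_nhdsWithin, mem_nhdsWithin_of_mem_nhds
    (Iio_mem_nhds (lt_add_of_pos_right t hε))]
  rintro u ⟨⟨⟨-, huT⟩, hu, -⟩, htu⟩ huε
  rw [mem_Ioi] at htu
  rw [mem_Iio] at huε
  have hlt := h (u - t) ⟨by linarith, by linarith⟩
  rw [add_sub_cancel] at hlt
  exact (hlt huT).not_ge (hu t ht0 htu.le)
end

section
/- Let κ and κ̃ be nonzero positive Radon measures on ℝ with κ ≤ κ̃. Let (u↑, u↓) be a pair of solutions of (1/2)u″ = uκ on ℝ, with u↑ positive non-decreasing, u↓ positive non-increasing, and Wronskian u↓·g↑ − u↑·g↓ identically equal to 2; let (ũ↑, ũ↓) be the analogous normalized pair of solutions of (1/2)u″ = uκ̃. Let n ≥ 1 and z₁, …, zₙ ∈ ℝ with κ̃({z_i}) = 0 for each i (hence also κ({z_i}) = 0, so u↑, u↓, ũ↑, ũ↓ are differentiable at each z_i). Define 𝒦(y, z) := −(1/2)·u↑′(min(y,z))·u↓′(max(y,z)) and 𝒦̃(y, z) := −(1/2)·ũ↑′(min(y,z))·ũ↓′(max(y,z)).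 Then det( 𝒦̃(z_i, z_j) )_{1≤i,j≤n} ≥ det( 𝒦(z_i, z_j) )_{1≤i,j≤n}. -/
open MeasureTheory Set

namespace IsSolKappaR

variable {κ κ' : Measure ℝ} {u g v h : ℝ → ℝ}

theorem linearCombination [IsLocallyFiniteMeasure κ] (hu : IsSolKappaR κ u g)
    (hv : IsSolKappaR κ v h) (hg : ∀ x y, IntervalIntegrable g volume x y)
    (hh : ∀ x y, IntervalIntegrable h volume x y)
    (c d : ℝ) :
    IsSolKappaR κ (fun x => c * u x + d * v x) (fun x => c * g x + d * h x) := by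
  obtain ⟨hu1, hu2, hu3, hu4⟩ := hu
  obtain ⟨hv1, hv2, hv3, hv4⟩ := hv
  refine ⟨by fun_prop, fun x => ((hu2 x).const_mul c).add ((hv2 x).const_mul d),
    fun x' x => ?_, fun x' x hx => ?_⟩
  · beta_reduce
    rw [intervalIntegral.integral_add ((hg _ _).const_mul c) ((hh _ _).const_mul d),
      intervalIntegral.integral_const_mul, intervalIntegral.integral_const_mul,
      hu3 x' x, hv3 x' x]
    ring
  · have i1 : IntegrableOn u (Ioc x' x) κ := hu1.integrableOn_Ioc
    have i2 : IntegrableOn v (Ioc x' x) κ := hv1.integrableOn_Ioc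
    rw [integral_add (i1.const_mul c) (i2.const_mul d), integral_const_mul, integral_const_mul]
    linear_combination c * hu4 x' x hx + d * hv4 x' x hx


theorem monotone_deriv (hu : IsSolKappaR κ u g) (hpos : ∀ x, 0 ≤ u x) : Monotone g := by
  intro x y hxy
  have := hu.2.2.2 x y hxy
  have h0 : 0 ≤ ∫ t in Ioc x y, u t ∂κ := integral_nonneg hpos
  linarith

theorem sub_le (hu : IsSolKappaR κ u g) (hg : Monotone g) {x y : ℝ} (hxy : x ≤ y) :
    u y - u x ≤ g y * (y - x) := by
  have h1 : ∫ t in x..y, g t ≤ ∫ _ in x..y, g y :=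
    intervalIntegral.integral_mono_on hxy hg.intervalIntegrable (by simp) fun t ht => hg ht.2
  rw [intervalIntegral.integral_const, smul_eq_mul] at h1
  have := hu.2.2.1 x y
  linarith

theorem le_sub (hu : IsSolKappaR κ u g) (hg : Monotone g) {x y : ℝ} (hxy : x ≤ y) :
    g x * (y - x) ≤ u y - u x := by
  have h1 : ∫ _ in x..y, g x ≤ ∫ t in x..y, g t :=
    intervalIntegral.integral_mono_on hxy (by simp) hg.intervalIntegrable fun t ht => hg ht.1
  rw [intervalIntegral.integral_const, smul_eq_mul] at h1
  have := hu.2.2.1 x y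
  linarith

theorem hasDerivAt [IsLocallyFiniteMeasure κ] (hu : IsSolKappaR κ u g) (hg : Monotone g)
    {z : ℝ} (hz : κ {z} = 0) :
    HasDerivAt u (g z) z := by
  have hc : ContinuousAt g z := by
    have h1 : ContinuousWithinAt (fun b => ∫ t in (z - 1)..b, u t ∂κ)
        (Icc (z - 1) (z + 1)) z :=
      intervalIntegral.continuousWithinAt_primitive hz (hu.1.intervalIntegrable _ _)
    have h2 : ContinuousWithinAt g (Icc (z - 1) (z + 1)) z := by
      refine ((h1.const_mul 2).add (continuousWithinAt_const (b := g (z - 1)))).congr ?_ ?_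
      · intro y hy
        rw [Pi.add_apply, intervalIntegral.integral_of_le hy.1]
        linarith [hu.2.2.2 (z - 1) y hy.1]
      · have : z - 1 ≤ z := by linarith
        rw [Pi.add_apply, intervalIntegral.integral_of_le this]
        linarith [hu.2.2.2 (z - 1) z this]
    exact h2.continuousAt (Icc_mem_nhds (by linarith) (by linarith))
  have h3 : HasDerivAt (fun x => ∫ t in (0 : ℝ)..x, g t) (g z) z :=
    intervalIntegral.integral_hasDerivAt_right hg.intervalIntegrable
      hg.measurable.stronglyMeasurable.stronglyMeasurableAtFilter hc
  have h4 : u = fun x => u 0 + ∫ t in (0 : ℝ)..x, g t := funext fun x => hu.2.2.1 0 x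
  rw [h4]
  exact h3.const_add _

theorem mul_sub_mul [IsLocallyFiniteMeasure κ] (hu1 : Continuous u)
    (hu3 : ∀ x' x : ℝ, u x = u x' + ∫ t in x'..x, g t)
    (hv : IsSolKappaR κ v h) (hg : Monotone g) (hh : Monotone h) {x y : ℝ} (hxy : x ≤ y) :
    u y * h y - u x * h x
      = 2 * (∫ t in Ioc x y, u t * v t ∂κ) + ∫ t in x..y, g t * h t := by
  have ig : IntegrableOn g (Ioc x y) volume :=
    (intervalIntegrable_iff_integrableOn_Ioc_of_le hxy).1 hg.intervalIntegrable
  have iv : IntegrableOn v (Ioc x y) κ := hv.1.integrableOn_Ioc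
  have huv : IntegrableOn (fun t => u t * v t) (Ioc x y) κ :=
    (hu1.mul hv.1).integrableOn_Ioc
  have igh : IntervalIntegrable (fun t => g t * h t) volume x y := by
    refine (intervalIntegrable_iff_integrableOn_Ioc_of_le hxy).2 ?_
    have ih : IntegrableOn h (Ioc x y) volume :=
      (intervalIntegrable_iff_integrableOn_Ioc_of_le hxy).1 hh.intervalIntegrable
    refine Integrable.bdd_mul (c := max |g x| |g y|) ih hg.measurable.aestronglyMeasurable ?_
    filter_upwards [ae_restrict_mem measurableSet_Ioc] with t ht
    exact abs_le_max_abs_abs (hg ht.1.le) (hg ht.2)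
  have hint : Integrable (fun p : ℝ × ℝ => {p : ℝ × ℝ | p.1 ≤ p.2}.indicator
      (fun p => v p.1 * g p.2) p)
      ((κ.restrict (Ioc x y)).prod (volume.restrict (Ioc x y))) :=
    (Integrable.mul_prod iv ig).indicator (measurableSet_le measurable_fst measurable_snd)
  have hswap := integral_integral_swap
    (f := fun t s => {p : ℝ × ℝ | p.1 ≤ p.2}.indicator (fun p => v p.1 * g p.2) (t, s)) hint
  have hl : ∀ t ∈ Ioc x y,
      (∫ s in Ioc x y, {p : ℝ × ℝ | p.1 ≤ p.2}.indicator (fun p => v p.1 * g p.2) (t, s))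
        = u y * v t - u t * v t := by
    intro t ht
    have e1 : (fun s => {p : ℝ × ℝ | p.1 ≤ p.2}.indicator (fun p => v p.1 * g p.2) (t, s))
        = (Ici t).indicator (fun s => v t * g s) := by
      ext s; simp [indicator]
    rw [e1, setIntegral_indicator measurableSet_Ici]
    have e2 : Ioc x y ∩ Ici t = Icc t y := by
      ext s; simp only [mem_inter_iff, mem_Ioc, mem_Ici, mem_Icc]
      exact ⟨fun hs => ⟨hs.2, hs.1.2⟩, fun hs => ⟨⟨ht.1.trans_le hs.1, hs.2⟩, hs.1⟩⟩
    rw [e2, integral_Icc_eq_integral_Ioc, integral_const_mul,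
      ← intervalIntegral.integral_of_le ht.2]
    linear_combination (-v t) * hu3 t y
  have hr : ∀ s ∈ Ioc x y,
      (∫ t in Ioc x y, {p : ℝ × ℝ | p.1 ≤ p.2}.indicator (fun p => v p.1 * g p.2) (t, s) ∂κ)
        = (g s * h s - g s * h x) / 2 := by
    intro s hs
    have e1 : (fun t => {p : ℝ × ℝ | p.1 ≤ p.2}.indicator (fun p => v p.1 * g p.2) (t, s))
        = (Iic s).indicator (fun t => v t * g s) := by
      ext t; simp [indicator]
    rw [e1, setIntegral_indicator measurableSet_Iic]
    have e2 : Ioc x y ∩ Iic s = Ioc x s := by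
      rw [Ioc_inter_Iic, min_eq_right hs.2]
    rw [e2, integral_mul_const]
    linear_combination (-g s / 2) * hv.2.2.2 x s hs.1.le
  rw [setIntegral_congr_fun measurableSet_Ioc hl, setIntegral_congr_fun measurableSet_Ioc hr,
    integral_sub (iv.const_mul _) huv, integral_const_mul, integral_div,
    ← intervalIntegral.integral_of_le (μ := volume) hxy,
    intervalIntegral.integral_sub igh (hg.intervalIntegrable.mul_const _),
    intervalIntegral.integral_mul_const] at hswap
  linear_combination 2 * hswap - u y * (hv.2.2.2 x y hxy) * (-1) + h x * hu3 x y

theorem wronskian_mono [IsLocallyFiniteMeasure κ] [IsLocallyFiniteMeasure κ']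
    (hle : κ ≤ κ') (hu : IsSolKappaR κ u g) (hv : IsSolKappaR κ' v h)
    (hu0 : ∀ x, 0 ≤ u x) (hv0 : ∀ x, 0 ≤ v x) :
    Monotone fun x => u x * h x - g x * v x := by
  intro x y hxy
  have hg := hu.monotone_deriv hu0
  have hh := hv.monotone_deriv hv0
  have h1 := mul_sub_mul hu.1 hu.2.2.1 hv hg hh hxy
  have h2 := mul_sub_mul hv.1 hv.2.2.1 hu hh hg hxy
  have h3 : ∫ t in Ioc x y, u t * v t ∂κ ≤ ∫ t in Ioc x y, u t * v t ∂κ' :=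
    integral_mono_measure (Measure.restrict_mono_measure hle _)
      (Filter.Eventually.of_forall fun t => mul_nonneg (hu0 t) (hv0 t))
      (hu.1.mul hv.1).integrableOn_Ioc
  simp only [mul_comm (v _), mul_comm (h _)] at h2
  simp only
  linarith

theorem deriv_nonneg (hu : IsSolKappaR κ u g) (hg : Monotone g) (hm : Monotone u) (x : ℝ) :
    0 ≤ g x := by
  have h1 := hu.sub_le hg (sub_one_lt x).le
  have h2 := hm (sub_one_lt x).le
  linarith

theorem deriv_nonpos (hu : IsSolKappaR κ u g) (hg : Monotone g) (hm : Antitone u) (x : ℝ) :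
    g x ≤ 0 := by
  have h1 := hu.le_sub hg (lt_add_one x).le
  have h2 := hm (lt_add_one x).le
  linarith

theorem wronskian_nonneg_of_monotone [IsLocallyFiniteMeasure κ] [IsLocallyFiniteMeasure κ']
    (hle : κ ≤ κ') (hu : IsSolKappaR κ u g)
    (hv : IsSolKappaR κ' v h) (hu0 : ∀ x, 0 ≤ u x) (hv0 : ∀ x, 0 ≤ v x)
    (hum : Monotone u) (hvm : Monotone v) (x : ℝ) :
    0 ≤ u x * h x - g x * v x := by
  have hg := hu.monotone_deriv hu0
  have hh := hv.monotone_deriv hv0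
  have hlim := tendsto_atBot_ciInf hum ⟨0, forall_mem_range.2 hu0⟩
  have hlim1 := hlim.comp (Filter.tendsto_atBot_add_const_right _ (1 : ℝ) Filter.tendsto_id)
  have hlim2 := (hlim.sub hlim1).mul_const (v x)
  rw [sub_self, zero_mul] at hlim2
  refine le_of_tendsto hlim2 ?_
  filter_upwards [Filter.eventually_le_atBot x] with t ht
  have h1 := wronskian_mono hle hu hv hu0 hv0 ht
  have h2 := hu.le_sub hg (lt_add_one t).le
  have h3 := mul_nonneg (hu0 t) (hv.deriv_nonneg hh hvm t)
  have h4 := mul_le_mul_of_nonneg_left (hvm ht) (hu.deriv_nonneg hg hum t)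
  have h5 := mul_le_mul_of_nonneg_right h2 (hv0 x)
  simp only [Function.comp_apply, id_eq] at h1 ⊢
  linarith

theorem wronskian_nonpos_of_antitone [IsLocallyFiniteMeasure κ] [IsLocallyFiniteMeasure κ']
    (hle : κ ≤ κ') (hu : IsSolKappaR κ u g)
    (hv : IsSolKappaR κ' v h) (hu0 : ∀ x, 0 ≤ u x) (hv0 : ∀ x, 0 ≤ v x)
    (hum : Antitone u) (hvm : Antitone v) (x : ℝ) :
    u x * h x - g x * v x ≤ 0 := by
  have hg := hu.monotone_deriv hu0
  have hh := hv.monotone_deriv hv0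
  have hlim := tendsto_atTop_ciInf hum ⟨0, forall_mem_range.2 hu0⟩
  have hlim1 := hlim.comp (Filter.tendsto_atTop_add_const_right _ (-1 : ℝ) Filter.tendsto_id)
  have hlim2 := (hlim1.sub hlim).mul_const (v x)
  rw [sub_self, zero_mul] at hlim2
  refine ge_of_tendsto hlim2 ?_
  filter_upwards [Filter.eventually_ge_atTop x] with t ht
  have h1 := wronskian_mono hle hu hv hu0 hv0 ht
  have h2 := hu.sub_le hg (x := t + -1) (y := t) (by linarith)
  have h3 := mul_nonneg (hu0 t) (neg_nonneg.2 (hv.deriv_nonpos hh hvm t))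
  have h4 := mul_le_mul_of_nonneg_left (hvm ht) (neg_nonneg.2 (hu.deriv_nonpos hg hum t))
  have h5 := mul_le_mul_of_nonneg_right h2 (hv0 x)
  simp only [Function.comp_apply, id_eq] at h1 ⊢
  linarith

end IsSolKappaR

section SemiseparableDet

/-- The matrix `a (min zᵢ zⱼ) * b (max zᵢ zⱼ)` of a one-pair kernel. -/
def onePairMatrix (a b : ℝ → ℝ) {n : ℕ} (z : Fin n → ℝ) : Matrix (Fin n) (Fin n) ℝ :=
  Matrix.of fun i j => a (min (z i) (z j)) * b (max (z i) (z j))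

variable {a b a' b' : ℝ → ℝ}

theorem mul_det_onePairMatrix {n : ℕ} {z : Fin (n + 2) → ℝ} (hz : StrictMono z) :
    b (z (Fin.last n).castSucc) * (onePairMatrix a b z).det
      = b (z (Fin.last (n + 1))) *
        (a (z (Fin.last (n + 1))) * b (z (Fin.last n).castSucc)
          - a (z (Fin.last n).castSucc) * b (z (Fin.last (n + 1))))
        * (onePairMatrix a b (z ∘ Fin.castSucc)).det := by
  set l := Fin.last (n + 1)
  set m := (Fin.last n).castSucc
  set A := onePairMatrix a b z with hA
  have hml : m ≠ l := (Fin.castSucc_lt_last _).ne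
  have h1 : b (z m) * A.det
      = (A.updateRow l (b (z m) • A l + (-b (z l)) • A m)).det := by
    rw [Matrix.det_updateRow_add, Matrix.det_updateRow_smul, Matrix.det_updateRow_smul,
      Matrix.updateRow_eq_self, Matrix.det_updateRow_eq_zero hml, mul_zero, add_zero]
  have hrow : ∀ j : Fin (n + 1),
      (b (z m) • A l + (-b (z l)) • A m) j.castSucc = 0 := by
    intro j
    have hj1 : z j.castSucc ≤ z l := hz.monotone (Fin.le_last _)
    have hj2 : z j.castSucc ≤ z m := hz.monotone (Fin.castSucc_le_castSucc_iff.2 (Fin.le_last j))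
    simp only [hA, onePairMatrix, Pi.add_apply, Pi.smul_apply, Matrix.of_apply, smul_eq_mul,
      min_eq_right hj1, max_eq_left hj1, min_eq_right hj2, max_eq_left hj2]
    ring
  have hml' : z m ≤ z l := hz.monotone (Fin.le_last _)
  have hlast : (b (z m) • A l + (-b (z l)) • A m) l
      = b (z l) * (a (z l) * b (z m) - a (z m) * b (z l)) := by
    simp only [hA, onePairMatrix, Pi.add_apply, Pi.smul_apply, Matrix.of_apply, smul_eq_mul,
      min_self, max_self, min_eq_left hml', max_eq_right hml']
    ring
  rw [h1, Matrix.det_succ_row _ l, Fin.sum_univ_castSucc, Finset.sum_eq_zero]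
  · rw [zero_add, Matrix.updateRow_self]
    have hsub : (A.updateRow l (b (z m) • A l + (-b (z l)) • A m)).submatrix
        l.succAbove (Fin.last (n + 1)).succAbove = onePairMatrix a b (z ∘ Fin.castSucc) := by
      ext i j
      simp [l, hA, onePairMatrix]
    rw [hsub, hlast, Even.neg_one_pow (Even.add_self _), one_mul]
  · intro j _
    rw [Matrix.updateRow_self, hrow]
    ring

theorem det_onePairMatrix_one (z : Fin 1 → ℝ) :
    (onePairMatrix a b z).det = a (z 0) * b (z 0) := by
  simp [onePairMatrix]

theorem det_onePairMatrix_eq_zero {n : ℕ} {z : Fin (n + 1) → ℝ} (hz : Monotone z)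
    (h0 : b (z (Fin.last n)) = 0) : (onePairMatrix a b z).det = 0 := by
  refine Matrix.det_eq_zero_of_row_eq_zero (Fin.last n) fun j => ?_
  simp [onePairMatrix, max_eq_left (hz (Fin.le_last j)), h0]

theorem det_onePairMatrix_nonneg (ha : ∀ x, 0 ≤ a x) (hb : ∀ x, 0 ≤ b x) (hanti : Antitone b)
    (hD : ∀ x y, x ≤ y → 0 ≤ a y * b x - a x * b y) {n : ℕ} {z : Fin (n + 1) → ℝ}
    (hz : StrictMono z) : 0 ≤ (onePairMatrix a b z).det := by
  induction n with
  | zero => rw [det_onePairMatrix_one]; exact mul_nonneg (ha _) (hb _)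
  | succ n ih =>
    have hml : z (Fin.last n).castSucc ≤ z (Fin.last (n + 1)) := hz.monotone (Fin.le_last _)
    rcases (hb (z (Fin.last n).castSucc)).eq_or_lt with h0 | h0
    · rw [det_onePairMatrix_eq_zero hz.monotone
        (le_antisymm (h0 ▸ hanti hml) (hb _))]
    · refine nonneg_of_mul_nonneg_right (a := b (z (Fin.last n).castSucc)) ?_ h0
      rw [mul_det_onePairMatrix hz]
      exact mul_nonneg (mul_nonneg (hb _) (hD _ _ hml)) (ih (hz.comp Fin.strictMono_castSucc))

theorem det_onePairMatrix_le (ha : ∀ x, 0 ≤ a x) (hb : ∀ x, 0 ≤ b x) (hanti : Antitone b)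
    (hD : ∀ x y, x ≤ y → 0 ≤ a y * b x - a x * b y)
    (ha' : ∀ x, 0 ≤ a' x) (hb' : ∀ x, 0 ≤ b' x) (hanti' : Antitone b')
    (hD' : ∀ x y, x ≤ y → 0 ≤ a' y * b' x - a' x * b' y)
    (hpos : ∀ x, 0 < b x → 0 < b' x) (hdiag : ∀ x, a x * b x ≤ a' x * b' x)
    (hstep : ∀ x y, x ≤ y → b' x * (b y * (a y * b x - a x * b y))
      ≤ b x * (b' y * (a' y * b' x - a' x * b' y)))
    {n : ℕ} {z : Fin (n + 1) → ℝ} (hz : StrictMono z) :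
    (onePairMatrix a b z).det ≤ (onePairMatrix a' b' z).det := by
  induction n with
  | zero => rw [det_onePairMatrix_one, det_onePairMatrix_one]; exact hdiag _
  | succ n ih =>
    have hml : z (Fin.last n).castSucc ≤ z (Fin.last (n + 1)) := hz.monotone (Fin.le_last _)
    rcases (hb (z (Fin.last n).castSucc)).eq_or_lt with h0 | h0
    · rw [det_onePairMatrix_eq_zero hz.monotone
        (le_antisymm (h0 ▸ hanti hml) (hb _))]
      exact det_onePairMatrix_nonneg ha' hb' hanti' hD' hz
    · have h0' := hpos _ h0
      have hz' := hz.comp Fin.strictMono_castSucc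
      have e := mul_det_onePairMatrix (a := a) (b := b) hz
      have e' := mul_det_onePairMatrix (a := a') (b := b') hz
      refine le_of_mul_le_mul_left ?_ (mul_pos h0 h0')
      have h1 := mul_le_mul_of_nonneg_right (hstep _ _ hml)
        (det_onePairMatrix_nonneg ha hb hanti hD hz')
      have h2 := mul_le_mul_of_nonneg_left (ih hz')
        (mul_nonneg h0.le (mul_nonneg (hb' (z (Fin.last (n + 1)))) (hD' _ _ hml)))
      linear_combination h1 + h2 + b' (z (Fin.last n).castSucc) * e
        - b (z (Fin.last n).castSucc) * e'

end SemiseparableDet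

/-- monotonicity in the killing measure of the determinants of the
kernel `𝒦(y,z) = −(1/2) u↑'(y∧z) u↓'(y∨z)`. -/
theorem det_kernel_K_monotone_in_killing
    (κ κ' : Measure ℝ) [IsLocallyFiniteMeasure κ] [IsLocallyFiniteMeasure κ']
    (hκ0 : κ ≠ 0) (hκ'0 : κ' ≠ 0) (hle : κ ≤ κ')
    (uup udown gup gdown : ℝ → ℝ)
    (hup : IsSolKappaR κ uup gup) (hdown : IsSolKappaR κ udown gdown)
    (huppos : ∀ x, 0 < uup x) (hupmono : Monotone uup)
    (hdownpos : ∀ x, 0 < udown x) (hdownanti : Antitone udown)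
    (hW : ∀ x, udown x * gup x - uup x * gdown x = 2)
    (tup tdown tgup tgdown : ℝ → ℝ)
    (htup : IsSolKappaR κ' tup tgup) (htdown : IsSolKappaR κ' tdown tgdown)
    (htuppos : ∀ x, 0 < tup x) (htupmono : Monotone tup)
    (htdownpos : ∀ x, 0 < tdown x) (htdownanti : Antitone tdown)
    (htW : ∀ x, tdown x * tgup x - tup x * tgdown x = 2)
    (n : ℕ) (hn : 0 < n) (z : Fin n → ℝ) (hz : ∀ i, κ' {z i} = 0) :
    (Matrix.of fun i j : Fin n =>
        -(1 / 2) * deriv uup (min (z i) (z j)) * deriv udown (max (z i) (z j))).det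
      ≤ (Matrix.of fun i j : Fin n =>
        -(1 / 2) * deriv tup (min (z i) (z j)) * deriv tdown (max (z i) (z j))).det := by
  have hu0 := fun x => (huppos x).le
  have hd0 := fun x => (hdownpos x).le
  have htu0 := fun x => (htuppos x).le
  have htd0 := fun x => (htdownpos x).le
  have mu := hup.monotone_deriv hu0
  have md := hdown.monotone_deriv hd0
  have mtu := htup.monotone_deriv htu0
  have mtd := htdown.monotone_deriv htd0
  have pu := hup.deriv_nonneg mu hupmono
  have pd := hdown.deriv_nonpos md hdownanti
  have ptu := htup.deriv_nonneg mtu htupmono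
  have ptd := htdown.deriv_nonpos mtd htdownanti
  have hz0 : ∀ i, κ {z i} = 0 := fun i => le_antisymm ((hle _).trans (hz i).le) zero_le
  have key : ∀ (ρ : Measure ℝ) [IsLocallyFiniteMeasure ρ] (u v g h : ℝ → ℝ),
      IsSolKappaR ρ u g → IsSolKappaR ρ v h → Monotone g → Monotone h → (∀ i, ρ {z i} = 0) →
      (Matrix.of fun i j : Fin n =>
        -(1 / 2) * deriv u (min (z i) (z j)) * deriv v (max (z i) (z j)))
      = onePairMatrix g (fun x => -(1 / 2) * h x) z := by
    intro ρ _ u v g h hu hv hg hh hρ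
    ext i j
    have hmin : ρ {min (z i) (z j)} = 0 := by
      rcases min_choice (z i) (z j) with e | e <;> rw [e] <;> exact hρ _
    have hmax : ρ {max (z i) (z j)} = 0 := by
      rcases max_choice (z i) (z j) with e | e <;> rw [e] <;> exact hρ _
    simp only [onePairMatrix, Matrix.of_apply, (hu.hasDerivAt hg hmin).deriv,
      (hv.hasDerivAt hh hmax).deriv]
    ring
  rw [key κ _ _ _ _ hup hdown mu md hz0, key κ' _ _ _ _ htup htdown mtu mtd hz]
  by_cases hinj : Function.Injective z
  swap
  · obtain ⟨i, j, hij, hne⟩ := Function.not_injective_iff.1 hinj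
    rw [Matrix.det_zero_of_row_eq hne (funext fun k => by simp [onePairMatrix, hij]),
      Matrix.det_zero_of_row_eq hne (funext fun k => by simp [onePairMatrix, hij])]
  have hsort : StrictMono (z ∘ Tuple.sort z) :=
    (Tuple.monotone_sort z).strictMono_of_injective (hinj.comp (Tuple.sort z).injective)
  rw [← Matrix.det_submatrix_equiv_self (Tuple.sort z) (onePairMatrix gup _ z),
    ← Matrix.det_submatrix_equiv_self (Tuple.sort z) (onePairMatrix tgup _ z)]
  obtain ⟨m, rfl⟩ : ∃ m, n = m + 1 := ⟨n - 1, by omega⟩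
  have wu := hup.wronskian_nonneg_of_monotone hle htup hu0 htu0 hupmono htupmono
  have wd := hdown.wronskian_nonpos_of_antitone hle htdown hd0 htd0 hdownanti htdownanti
  have wC : ∀ x y, x ≤ y →
      0 ≤ (gup x * udown y + -gdown x * uup y) * (tgup x * tgdown y + -tgdown x * tgup y)
        - (gup x * gdown y + -gdown x * gup y) * (tgup x * tdown y + -tgdown x * tup y) := by
    intro x y hxy
    have h1 := hdown.linearCombination hup (fun _ _ => md.intervalIntegrable)
      (fun _ _ => mu.intervalIntegrable) (gup x) (-gdown x)
    have h2 := htdown.linearCombination htup (fun _ _ => mtd.intervalIntegrable)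
      (fun _ _ => mtu.intervalIntegrable) (tgup x) (-tgdown x)
    have h3 := IsSolKappaR.wronskian_mono hle h1 h2
      (fun t => add_nonneg (mul_nonneg (pu x) (hd0 t)) (mul_nonneg (neg_nonneg.2 (pd x)) (hu0 t)))
      (fun t => add_nonneg (mul_nonneg (ptu x) (htd0 t))
        (mul_nonneg (neg_nonneg.2 (ptd x)) (htu0 t))) hxy
    refine le_trans (le_of_eq ?_) h3
    ring
  have hDu : ∀ x y, x ≤ y → 0 ≤ gup x * gdown y + -gdown x * gup y := fun x y hxy => by
    nlinarith [mul_le_mul_of_nonneg_right (mu hxy) (neg_nonneg.2 (pd x)),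
      mul_le_mul_of_nonneg_left (md hxy) (pu x)]
  have hDtu : ∀ x y, x ≤ y → 0 ≤ tgup x * tgdown y + -tgdown x * tgup y := fun x y hxy => by
    nlinarith [mul_le_mul_of_nonneg_right (mtu hxy) (neg_nonneg.2 (ptd x)),
      mul_le_mul_of_nonneg_left (mtd hxy) (ptu x)]
  change (onePairMatrix gup (fun x => -(1 / 2) * gdown x) (z ∘ Tuple.sort z)).det
    ≤ (onePairMatrix tgup (fun x => -(1 / 2) * tgdown x) (z ∘ Tuple.sort z)).det
  refine det_onePairMatrix_le pu (fun x => ?_) (fun x y hxy => ?_) (fun x y hxy => ?_) ptu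
    (fun x => ?_) (fun x y hxy => ?_) (fun x y hxy => ?_) (fun x hx => ?_) (fun x => ?_)
    (fun x y hxy => ?_) hsort
  · linarith [pd x]
  · linarith [md hxy]
  · linarith [hDu x y hxy]
  · linarith [ptd x]
  · linarith [mtd hxy]
  · linarith [hDtu x y hxy]
  · have h1 : gdown x < 0 := by linarith
    by_contra hcon
    have h2 : tgdown x = 0 := le_antisymm (ptd x) (by linarith)
    have h3 := wd x
    rw [h2] at h3
    nlinarith [htdownpos x]
  · have h1 := mul_nonneg (mul_nonneg (pu x) (ptu x)) (neg_nonneg.2 (wd x))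
    have h2 := mul_nonneg (mul_nonneg (neg_nonneg.2 (pd x)) (neg_nonneg.2 (ptd x))) (wu x)
    linear_combination (1 / 4) * h1 + (1 / 4) * h2 + (1 / 4) * gup x * gdown x * htW x
      - (1 / 4) * tgup x * tgdown x * hW x
  · have h1 := mul_nonneg (mul_nonneg (neg_nonneg.2 (pd y)) (neg_nonneg.2 (ptd y)))
      (wC x y hxy)
    have h2 := mul_nonneg (mul_nonneg (hDu x y hxy) (hDtu x y hxy)) (neg_nonneg.2 (wd y))
    linear_combination (1 / 16) * h1 + (1 / 16) * h2
      + (1 / 16) * gdown x * tgdown y * (tgup x * tgdown y + -tgdown x * tgup y) * hW y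
      - (1 / 16) * tgdown x * gdown y * (gup x * gdown y + -gdown x * gup y) * htW y
end

section
/- Let κ be a nonzero positive Radon measure on ℝ and c > 1. Let (u↑, u↓) be a pair of solutions of (1/2)u″ = uκ on ℝ, with u↑ positive non-decreasing, u↓ positive non-increasing, and Wronskian u↓·g↑ − u↑·g↓ identically equal to 2; let (ũ↑, ũ↓) be the analogous normalized pair of solutions of (1/2)u″ = u·(cκ). Set G(x,y) := u↑(min(x,y))·u↓(max(x,y)) and G̃(x,y) := ũ↑(min(x,y))·ũ↓(max(x,y)). Then for every n ≥ 1 and all points y₁, …, yₙ in the topological support of κ: cⁿ·det( G̃(y_i, y_j) )_{1≤i,j≤n} ≥ det( G(y_i, y_j) )_{1≤i,j≤n}. -/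
open MeasureTheory Set

/-- `u` solves `u'' = k u κ` with locally integrable right-derivative `g`. -/
structure IsKilledSol (κ : Measure ℝ) (k : ℝ) (u g : ℝ → ℝ) : Prop where
  cont : Continuous u
  intervalIntegrable : ∀ a b, IntervalIntegrable g volume a b
  sub_eq : ∀ a b, u b - u a = ∫ t in a..b, g t
  deriv_sub : ∀ a b, a ≤ b → g b - g a = k * ∫ t in Ioc a b, u t ∂κ

namespace IsKilledSol

variable {κ : Measure ℝ} {k l : ℝ} {u g v h : ℝ → ℝ}

theorem monotone_deriv_of_nonneg (hk : 0 ≤ k) (hu : ∀ x, 0 ≤ u x)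
    (hg : ∀ a b, a ≤ b → g b - g a = k * ∫ t in Ioc a b, u t ∂κ) : Monotone g := by
  intro a b hab
  have h1 := hg a b hab
  have h2 : 0 ≤ ∫ t in Ioc a b, u t ∂κ := integral_nonneg fun t => hu t
  nlinarith [mul_nonneg hk h2]

theorem integrableOn [IsLocallyFiniteMeasure κ] (hu : Continuous u) (a b : ℝ) :
    IntegrableOn u (Ioc a b) κ :=
  (hu.continuousOn.integrableOn_compact isCompact_Icc).mono_set Ioc_subset_Icc_self

theorem linear_comb [IsLocallyFiniteMeasure κ] (hu : IsKilledSol κ k u g)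
    (hv : IsKilledSol κ k v h) (p q : ℝ) :
    IsKilledSol κ k (fun x => u x * p - v x * q) (fun x => g x * p - h x * q) where
  cont := (hu.cont.mul continuous_const).sub (hv.cont.mul continuous_const)
  intervalIntegrable a b :=
    ((hu.intervalIntegrable a b).mul_const p).sub ((hv.intervalIntegrable a b).mul_const q)
  sub_eq a b := by
    rw [intervalIntegral.integral_sub ((hu.intervalIntegrable a b).mul_const p)
      ((hv.intervalIntegrable a b).mul_const q), intervalIntegral.integral_mul_const,
      intervalIntegral.integral_mul_const, ← hu.sub_eq, ← hv.sub_eq]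
    ring
  deriv_sub a b hab := by
    rw [integral_sub ((integrableOn hu.cont a b).mul_const p)
      ((integrableOn hv.cont a b).mul_const q), integral_mul_const, integral_mul_const]
    linear_combination p * hu.deriv_sub a b hab - q * hv.deriv_sub a b hab

/-- Integration by parts for the product of the right-derivative of a solution and another
solution. -/
theorem deriv_mul_sub [IsLocallyFiniteMeasure κ] (hu : IsKilledSol κ k u g)
    (hv : IsKilledSol κ l v h) {a b : ℝ} (hab : a ≤ b) :
    g b * v b - g a * v a = (∫ t in a..b, g t * h t) + k * ∫ t in Ioc a b, u t * v t ∂κ := by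
  have hui := integrableOn (κ := κ) hu.cont a b
  have hhi : IntegrableOn h (Ioc a b) volume := (hv.intervalIntegrable a b).1
  have hswap : ∫ t in Ioc a b, (∫ s in Ioc a b, (Ici t).indicator (fun s => u t * h s) s) ∂κ
      = ∫ s in Ioc a b, (∫ t in Ioc a b, (Iic s).indicator (fun t => u t * h s) t ∂κ) := by
    have hint : Integrable (fun z : ℝ × ℝ => {z : ℝ × ℝ | z.1 ≤ z.2}.indicator
        (fun z => u z.1 * h z.2) z)
        ((κ.restrict (Ioc a b)).prod (volume.restrict (Ioc a b))) :=
      (Integrable.mul_prod hui hhi).indicator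
        (measurableSet_le measurable_fst measurable_snd)
    exact integral_integral_swap
      (f := fun t s => {z : ℝ × ℝ | z.1 ≤ z.2}.indicator (fun z => u z.1 * h z.2) (t, s)) hint
  have hleft : ∫ t in Ioc a b, (∫ s in Ioc a b, (Ici t).indicator (fun s => u t * h s) s) ∂κ
      = v b * (∫ t in Ioc a b, u t ∂κ) - ∫ t in Ioc a b, u t * v t ∂κ := by
    rw [← integral_const_mul, ← integral_sub (hui.const_mul _)
      (show IntegrableOn (fun t => u t * v t) (Ioc a b) κ from
        integrableOn (hu.cont.mul hv.cont) a b)]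
    refine setIntegral_congr_fun measurableSet_Ioc fun t ht => ?_
    have hset : Ioc a b ∩ Ici t = Icc t b := by
      ext s; simp only [mem_inter_iff, mem_Ioc, mem_Ici, mem_Icc]
      exact ⟨fun hs => ⟨hs.2, hs.1.2⟩, fun hs => ⟨⟨ht.1.trans_le hs.1, hs.2⟩, hs.1⟩⟩
    rw [setIntegral_indicator measurableSet_Ici, hset, integral_Icc_eq_integral_Ioc,
      integral_const_mul, ← intervalIntegral.integral_of_le ht.2, ← hv.sub_eq]
    ring
  have hright : k * ∫ s in Ioc a b, (∫ t in Ioc a b, (Iic s).indicator (fun t => u t * h s) t ∂κ)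
      = (∫ t in a..b, g t * h t) - g a * (v b - v a) := by
    have hrepr : ∀ s ∈ Ioc a b,
        k * (∫ t in Ioc a b, (Iic s).indicator (fun t => u t * h s) t ∂κ)
          = g s * h s - g a * h s := by
      intro s hs
      have hset : Ioc a b ∩ Iic s = Ioc a s := by
        ext t; simp only [mem_inter_iff, mem_Ioc, mem_Iic]
        exact ⟨fun ht => ⟨ht.1.1, ht.2⟩, fun ht => ⟨⟨ht.1, ht.2.trans hs.2⟩, ht.2⟩⟩
      rw [setIntegral_indicator measurableSet_Iic, hset, integral_mul_const, ← mul_assoc,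
        ← hu.deriv_sub a s hs.1.le]
      ring
    have hgh : IntegrableOn (fun t => g t * h t) (Ioc a b) volume := by
      obtain ⟨C, hC⟩ : ∃ C, ∀ s ∈ Ioc a b, ‖g s‖ ≤ C := by
        refine ⟨‖g a‖ + |k| * ∫ t in Ioc a b, ‖u t‖ ∂κ, fun s hs => ?_⟩
        have h1 := hu.deriv_sub a s hs.1.le
        have h2 : ‖∫ t in Ioc a s, u t ∂κ‖ ≤ ∫ t in Ioc a b, ‖u t‖ ∂κ :=
          (norm_integral_le_integral_norm _).trans
            (setIntegral_mono_set hui.norm (Filter.Eventually.of_forall fun t => norm_nonneg _)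
              (Ioc_subset_Ioc_right hs.2).eventuallyLE)
        calc ‖g s‖ = ‖g a + k * ∫ t in Ioc a s, u t ∂κ‖ := by rw [← h1]; ring_nf
          _ ≤ ‖g a‖ + ‖k * ∫ t in Ioc a s, u t ∂κ‖ := norm_add_le _ _
          _ ≤ _ := by
            rw [norm_mul, Real.norm_eq_abs k]
            gcongr
      exact Integrable.bdd_mul hhi (hu.intervalIntegrable a b).1.aestronglyMeasurable
        (ae_restrict_of_forall_mem measurableSet_Ioc hC)
    rw [← integral_const_mul, setIntegral_congr_fun measurableSet_Ioc hrepr,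
      integral_sub hgh (hhi.const_mul _), integral_const_mul, hv.sub_eq,
      intervalIntegral.integral_of_le hab, intervalIntegral.integral_of_le hab]
  rw [← hswap, hleft] at hright
  linear_combination hright + v b * hu.deriv_sub a b hab

/-- The killing measure cancels in the increments of `c u' v - v' u`. -/
theorem scaled_wronskian_sub [IsLocallyFiniteMeasure κ] {c : ℝ} (hu : IsKilledSol κ k u g)
    (hv : IsKilledSol κ (k * c) v h) {a b : ℝ} (hab : a ≤ b) :
    (c * g b * v b - h b * u b) - (c * g a * v a - h a * u a)
      = (c - 1) * ∫ t in a..b, g t * h t := by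
  have h1 := hu.deriv_mul_sub hv hab
  have h2 := hv.deriv_mul_sub hu hab
  simp only [mul_comm (h _), mul_comm (v _)] at h2
  linear_combination c * h1 - h2

theorem scaled_wronskian_le [IsLocallyFiniteMeasure κ] {c : ℝ} (hc : 1 < c)
    (hu : IsKilledSol κ k u g) (hv : IsKilledSol κ (k * c) v h)
    (hgh : ∀ t, 0 ≤ g t * h t) {a b : ℝ} (hab : a ≤ b) :
    c * g a * v a - h a * u a ≤ c * g b * v b - h b * u b := by
  have h1 := hu.scaled_wronskian_sub hv hab
  have h2 := intervalIntegral.integral_nonneg (μ := volume) hab fun t _ => hgh t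
  nlinarith [mul_nonneg (sub_pos.2 hc).le h2]

theorem deriv_mul_le_sub (hu : IsKilledSol κ k u g) (hg : Monotone g) (x y : ℝ) :
    g x * (y - x) ≤ u y - u x := by
  have hconst : ∫ _ in x..y, g x = g x * (y - x) := by
    rw [intervalIntegral.integral_const, smul_eq_mul, mul_comm]
  rw [← hconst]
  rcases le_total x y with hxy | hxy
  · rw [hu.sub_eq x y]
    exact intervalIntegral.integral_mono_on hxy intervalIntegrable_const
      (hu.intervalIntegrable x y) fun t ht => hg ht.1
  · rw [intervalIntegral.integral_symm, hu.sub_eq x y, intervalIntegral.integral_symm y x,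
      neg_le_neg_iff]
    exact intervalIntegral.integral_mono_on hxy (hu.intervalIntegrable y x)
      intervalIntegrable_const fun t ht => hg ht.2

theorem deriv_nonneg (hu : IsKilledSol κ k u g) (hg : Monotone g) (hmono : Monotone u) (x : ℝ) :
    0 ≤ g x := by
  have h1 := hu.deriv_mul_le_sub hg x (x - 1)
  have h2 := hmono (sub_le_self x zero_le_one)
  linarith

theorem deriv_nonpos (hu : IsKilledSol κ k u g) (hg : Monotone g) (hanti : Antitone u) (x : ℝ) :
    g x ≤ 0 := by
  have h1 := hu.deriv_mul_le_sub hg x (x + 1)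
  have h2 := hanti (le_add_of_nonneg_right zero_le_one : x ≤ x + 1)
  linarith

/-- Comparison of logarithmic derivatives of increasing solutions. -/
theorem scaled_wronskian_nonneg [IsLocallyFiniteMeasure κ] {c : ℝ} (hc : 1 < c)
    (hu : IsKilledSol κ k u g) (hv : IsKilledSol κ (k * c) v h)
    (hg : Monotone g) (hh : Monotone h) (hu0 : ∀ x, 0 < u x) (hv0 : ∀ x, 0 < v x)
    (hum : Monotone u) (hvm : Monotone v) (x : ℝ) :
    0 ≤ c * g x * v x - h x * u x := by
  have hg0 := hu.deriv_nonneg hg hum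
  have hh0 := hv.deriv_nonneg hh hvm
  refine le_of_forall_pos_lt_add fun ε hε => ?_
  set r := u x * v x / ε + 1 with hr
  have hr0 : 0 < r := by have := hu0 x; have := hv0 x; positivity
  have hle : x - r ≤ x := by linarith
  have hF := hu.scaled_wronskian_le hc hv (fun t => mul_nonneg (hg0 t) (hh0 t)) hle
  have hpos : 0 ≤ c * g (x - r) * v (x - r) :=
    mul_nonneg (mul_nonneg (by linarith) (hg0 _)) (hv0 _).le
  have hdec : h (x - r) * r ≤ v x := by
    have h1 := hv.deriv_mul_le_sub hh (x - r) x
    have h2 := hv0 (x - r)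
    rw [sub_sub_cancel] at h1
    linarith
  have hsmall : h (x - r) * u (x - r) < ε := by
    have h1 : h (x - r) * u (x - r) ≤ h (x - r) * u x :=
      mul_le_mul_of_nonneg_left (hum hle) (hh0 _)
    have h2 : u x * v x < ε * r := by rw [hr, mul_add, mul_div_cancel₀ _ hε.ne']; linarith
    have h3 : h (x - r) * u x * r ≤ u x * v x := by
      nlinarith [mul_le_mul_of_nonneg_left hdec (hu0 x).le]
    exact h1.trans_lt (lt_of_mul_lt_mul_right (h3.trans_lt h2) hr0.le)
  linarith

/-- Comparison of logarithmic derivatives of decreasing solutions. -/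
theorem scaled_wronskian_nonpos [IsLocallyFiniteMeasure κ] {c : ℝ} (hc : 1 < c)
    (hu : IsKilledSol κ k u g) (hv : IsKilledSol κ (k * c) v h)
    (hg : Monotone g) (hh : Monotone h) (hu0 : ∀ x, 0 < u x) (hv0 : ∀ x, 0 < v x)
    (hum : Antitone u) (hvm : Antitone v) (x : ℝ) :
    c * g x * v x - h x * u x ≤ 0 := by
  have hg0 := hu.deriv_nonpos hg hum
  have hh0 := hv.deriv_nonpos hh hvm
  refine le_of_forall_pos_lt_add fun ε hε => ?_
  set r := u x * v x / ε + 1 with hr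
  have hr0 : 0 < r := by have := hu0 x; have := hv0 x; positivity
  have hle : x ≤ x + r := by linarith
  have hF := hu.scaled_wronskian_le hc hv
    (fun t => mul_nonneg_of_nonpos_of_nonpos (hg0 t) (hh0 t)) hle
  have hneg : c * g (x + r) * v (x + r) ≤ 0 :=
    mul_nonpos_of_nonpos_of_nonneg
      (mul_nonpos_of_nonneg_of_nonpos (by linarith) (hg0 _)) (hv0 _).le
  have hdec : -h (x + r) * r ≤ v x := by
    have h1 := hv.deriv_mul_le_sub hh (x + r) x
    have h2 := hv0 (x + r)
    rw [sub_add_cancel_left] at h1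
    linarith
  have hsmall : -h (x + r) * u (x + r) < ε := by
    have h1 : -h (x + r) * u (x + r) ≤ -h (x + r) * u x :=
      mul_le_mul_of_nonneg_left (hum hle) (neg_nonneg.2 (hh0 _))
    have h2 : u x * v x < ε * r := by rw [hr, mul_add, mul_div_cancel₀ _ hε.ne']; linarith
    have h3 : -h (x + r) * u x * r ≤ u x * v x := by
      nlinarith [mul_le_mul_of_nonneg_left hdec (hu0 x).le]
    exact h1.trans_lt (lt_of_mul_lt_mul_right (h3.trans_lt h2) hr0.le)
  linarith

end IsKilledSol

theorem IsSolKappaR.monotone_deriv_s19 {κ : Measure ℝ} {u g : ℝ → ℝ} (hu : IsSolKappaR κ u g)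
    (hu0 : ∀ x, 0 < u x) : Monotone g :=
  IsKilledSol.monotone_deriv_of_nonneg zero_le_two (fun x => (hu0 x).le) hu.2.2.2

theorem IsSolKappaR.isKilledSol {κ : Measure ℝ} {u g : ℝ → ℝ} {c : ℝ} (hc : 0 ≤ c)
    (hu : IsSolKappaR (ENNReal.ofReal c • κ) u g) (hg : Monotone g) :
    IsKilledSol κ (2 * c) u g where
  cont := hu.1
  intervalIntegrable _ _ := hg.intervalIntegrable
  sub_eq a b := by rw [hu.2.2.1 a b]; ring
  deriv_sub a b hab := by
    rw [hu.2.2.2 a b hab, Measure.restrict_smul, integral_smul_measure,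
      ENNReal.toReal_ofReal hc, smul_eq_mul, mul_assoc]

/-- The Green matrix with kernel `f (min x y) * h (max x y)` evaluated at the points `y`. -/
def greenMatrix (f h : ℝ → ℝ) {n : ℕ} (y : Fin n → ℝ) : Matrix (Fin n) (Fin n) ℝ :=
  Matrix.of fun i j => f (min (y i) (y j)) * h (max (y i) (y j))

theorem det_greenMatrix_succ (f h : ℝ → ℝ) (hf : ∀ x, 0 < f x) {n : ℕ} (y : Fin (n + 2) → ℝ)
    (hy : Monotone y) :
    (greenMatrix f h y).det
      = f (y 0) * (h (y 0) * f (y 1) - f (y 0) * h (y 1)) / f (y 1)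
        * (greenMatrix f h (y ∘ Fin.succ)).det := by
  have hf1 := (hf (y 1)).ne'
  have h01 : (0 : Fin (n + 2)) ≠ 1 := by simp
  rw [← Matrix.det_updateRow_add_smul_self (greenMatrix f h y) h01 (-(f (y 0) / f (y 1))),
    Matrix.det_succ_row_zero, Fin.sum_univ_succ]
  rw [Finset.sum_eq_zero, add_zero]
  · have hsub : ((greenMatrix f h y).updateRow 0
        (greenMatrix f h y 0 + (-(f (y 0) / f (y 1))) • greenMatrix f h y 1)).submatrix
          Fin.succ (Fin.succAbove 0) = greenMatrix f h (y ∘ Fin.succ) := by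
      ext i j
      simp [greenMatrix]
    rw [hsub]
    have := hy (Fin.zero_le (1 : Fin (n + 2)))
    simp only [Matrix.updateRow_self, greenMatrix, Pi.add_apply, Pi.smul_apply, Matrix.of_apply,
      min_self, max_self, min_eq_right this, max_eq_left this, smul_eq_mul, Fin.val_zero,
      pow_zero, one_mul]
    congr 1
    field_simp
    ring
  · intro j _
    have h0 : y 0 ≤ y j.succ := hy (Fin.zero_le _)
    have h1 : y 1 ≤ y j.succ := hy (by
      rw [← Fin.succ_zero_eq_one]; exact Fin.succ_le_succ_iff.2 (Fin.zero_le _))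
    simp only [Matrix.updateRow_self, greenMatrix, Pi.add_apply, Pi.smul_apply, Matrix.of_apply,
      min_eq_left h0, max_eq_right h0, min_eq_left h1, max_eq_right h1, smul_eq_mul]
    field_simp
    ring

theorem det_greenMatrix_le (f h f' h' : ℝ → ℝ) (c : ℝ)
    (hf : ∀ x, 0 < f x) (hf' : ∀ x, 0 < f' x) (hh : ∀ x, 0 < h x) (hfm : Monotone f)
    (hhm : Antitone h) (hdiag : ∀ x, f x * h x ≤ c * (f' x * h' x))
    (hstep : ∀ x y, x ≤ y → f x * (h x * f y - f x * h y) / f y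
      ≤ c * (f' x * (h' x * f' y - f' x * h' y) / f' y))
    (n : ℕ) (y : Fin (n + 1) → ℝ) (hy : Monotone y) :
    0 ≤ (greenMatrix f h y).det ∧
      (greenMatrix f h y).det ≤ c ^ (n + 1) * (greenMatrix f' h' y).det := by
  induction n with
  | zero =>
    simpa [greenMatrix, hdiag] using (mul_pos (hf (y 0)) (hh (y 0))).le
  | succ n ih =>
    obtain ⟨ih0, ih1⟩ := ih (y ∘ Fin.succ) (hy.comp (Fin.strictMono_succ).monotone)
    rw [det_greenMatrix_succ f h hf y hy, det_greenMatrix_succ f' h' hf' y hy]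
    have h01 : y 0 ≤ y 1 := hy (Fin.zero_le _)
    have hs := hstep _ _ h01
    have hD : 0 ≤ f (y 0) * (h (y 0) * f (y 1) - f (y 0) * h (y 1)) / f (y 1) := by
      refine div_nonneg (mul_nonneg (hf _).le ?_) (hf _).le
      have := mul_le_mul (hhm h01) (hfm h01) (hf _).le (hh _).le
      linarith
    refine ⟨mul_nonneg hD ih0, (mul_le_mul hs ih1 ih0 (hD.trans hs)).trans_eq ?_⟩
    ring

/-- for `κ̃ = c κ` with `c > 1`, the determinants of the Green kernels
`G` of `κ` and `G̃` of `c κ` at points of the support of `κ` satisfy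
`cⁿ det(G̃(yᵢ,yⱼ)) ≥ det(G(yᵢ,yⱼ))`. -/
theorem det_green_kernel_comparison_scaled_killing
    (κ : Measure ℝ) [IsLocallyFiniteMeasure κ] (hκ0 : κ ≠ 0)
    (c : ℝ) (hc : 1 < c)
    (uup udown gup gdown : ℝ → ℝ)
    (hup : IsSolKappaR κ uup gup) (hdown : IsSolKappaR κ udown gdown)
    (huppos : ∀ x, 0 < uup x) (hupmono : Monotone uup)
    (hdownpos : ∀ x, 0 < udown x) (hdownanti : Antitone udown)
    (hW : ∀ x, udown x * gup x - uup x * gdown x = 2)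
    (tup tdown tgup tgdown : ℝ → ℝ)
    (htup : IsSolKappaR (ENNReal.ofReal c • κ) tup tgup)
    (htdown : IsSolKappaR (ENNReal.ofReal c • κ) tdown tgdown)
    (htuppos : ∀ x, 0 < tup x) (htupmono : Monotone tup)
    (htdownpos : ∀ x, 0 < tdown x) (htdownanti : Antitone tdown)
    (htW : ∀ x, tdown x * tgup x - tup x * tgdown x = 2)
    (n : ℕ) (hn : 0 < n) (y : Fin n → ℝ)
    (hy : ∀ i, ∀ ε : ℝ, 0 < ε → 0 < κ (Ioo (y i - ε) (y i + ε))) :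
    (Matrix.of fun i j : Fin n =>
        uup (min (y i) (y j)) * udown (max (y i) (y j))).det
      ≤ c ^ n * (Matrix.of fun i j : Fin n =>
        tup (min (y i) (y j)) * tdown (max (y i) (y j))).det := by
  have hc0 : 0 ≤ c := by linarith
  have hgup := hup.monotone_deriv_s19 huppos
  have hgdown := hdown.monotone_deriv_s19 hdownpos
  have htgup := htup.monotone_deriv_s19 htuppos
  have htgdown := htdown.monotone_deriv_s19 htdownpos
  have toSol {u g : ℝ → ℝ} (hu : IsSolKappaR κ u g) (hg : Monotone g) :
      IsKilledSol κ 2 u g := by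
    have hu' : IsSolKappaR (ENNReal.ofReal 1 • κ) u g := by simpa using hu
    simpa using hu'.isKilledSol zero_le_one hg
  have sup := toSol hup hgup
  have sdown := toSol hdown hgdown
  have stup := htup.isKilledSol hc0 htgup
  have stdown := htdown.isKilledSol hc0 htgdown
  have hFup := sup.scaled_wronskian_nonneg hc stup hgup htgup huppos htuppos hupmono htupmono
  have hFdown := sdown.scaled_wronskian_nonpos hc stdown hgdown htgdown hdownpos htdownpos
    hdownanti htdownanti
  have hdiag : ∀ x, uup x * udown x ≤ c * (tup x * tdown x) := by
    intro x
    have h1 := mul_nonneg (mul_pos (hdownpos x) (htdownpos x)).le (hFup x)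
    have h2 := mul_nonneg (mul_pos (huppos x) (htuppos x)).le (neg_nonneg.2 (hFdown x))
    linear_combination (h1 + h2 - uup x * udown x * htW x + c * (tup x * tdown x) * hW x) / 2
  have hstep : ∀ x y, x ≤ y → uup x * (udown x * uup y - uup x * udown y) / uup y
      ≤ c * (tup x * (tdown x * tup y - tup x * tdown y) / tup y) := by
    intro x y hxy
    have hF := (sdown.linear_comb sup (uup y) (udown y)).scaled_wronskian_le hc
      (stdown.linear_comb stup (tup y) (tdown y)) (fun t => by
        refine mul_nonneg_of_nonpos_of_nonpos ?_ ?_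
        · nlinarith [mul_nonneg (neg_nonneg.2 (sdown.deriv_nonpos hgdown hdownanti t))
            (huppos y).le, mul_nonneg (sup.deriv_nonneg hgup hupmono t) (hdownpos y).le]
        · nlinarith [mul_nonneg (neg_nonneg.2 (stdown.deriv_nonpos htgdown htdownanti t))
            (htuppos y).le, mul_nonneg (stup.deriv_nonneg htgup htupmono t) (htdownpos y).le]) hxy
    have hD : 0 ≤ udown x * uup y - uup x * udown y := by
      linarith [mul_le_mul (hdownanti hxy) (hupmono hxy) (huppos _).le (hdownpos _).le]
    have htD : 0 ≤ tdown x * tup y - tup x * tdown y := by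
      linarith [mul_le_mul (htdownanti hxy) (htupmono hxy) (htuppos _).le (htdownpos _).le]
    have h1 := mul_nonneg (mul_nonneg hD htD) (hFup x)
    have h2 := mul_le_mul_of_nonneg_left hF (mul_pos (huppos x) (htuppos x)).le
    rw [← mul_div_assoc, div_le_div_iff₀ (huppos y) (htuppos y)]
    linear_combination (h1 + h2
      - uup x * (udown x * uup y - uup x * udown y) * tup y * htW x
      + c * (tup x * (tdown x * tup y - tup x * tdown y)) * uup y * hW x) / 2
  obtain ⟨m, rfl⟩ : ∃ m, n = m + 1 := ⟨n - 1, by lia⟩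
  have key := (det_greenMatrix_le uup udown tup tdown c huppos htuppos hdownpos hupmono
    hdownanti hdiag hstep m (y ∘ Tuple.sort y) (Tuple.monotone_sort y)).2
  have hperm : ∀ f h : ℝ → ℝ,
      (greenMatrix f h (y ∘ Tuple.sort y)).det = (greenMatrix f h y).det := fun f h =>
    Matrix.det_submatrix_equiv_self (Tuple.sort y) (greenMatrix f h y)
  rw [hperm, hperm] at key
  exact key
end
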